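/- arXiv:1712.04169 — 3 statements merged into one kernel-verified Lean document; each statement's English description precedes it below -/
import Mathlib

section
/- For all λ ∈ ℚ^n, ∑_{A ⊆ Δ_n^+(𝔩)} ∑_{C ⊆ Δ(𝔭_1)} (−1)^{|A|+|C|} P_K(λ − σ(A) − σ(C)) = (−1)^{k(p−k) + k(q−p) + (p−k)(q−p+k)} · (p choose k) · P_{K∩L}(λ). (This polynomial identity computes, for G_ℝ = SU(p,q), the constant c_k = (−1)^{k(n−k)}·(p choose k) relating the Dirac index polynomial to the multiplicity of the k-th real form of the nilpotent orbit in the associated cycle.) -/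
open Finset

/-- Product over a block `B` of indices of `(λ_i - λ_j)/(j - i)` over pairs `i < j` in `B`. -/
def blockProd (B : Finset ℕ) (lam : ℕ → ℚ) : ℚ :=
  ∏ i ∈ B, ∏ j ∈ B, if i < j then (lam i - lam j) / ((j : ℚ) - (i : ℚ)) else 1

/-- The Weyl dimension polynomial `P_K` for `K = S(U(p) × U(q))`:
`P_K(λ) = ∏_{1≤i<j≤p} (λ_i−λ_j)/(j−i) · ∏_{p+1≤i<j≤p+q} (λ_i−λ_j)/(j−i)`. -/
def PK (p q : ℕ) (lam : ℕ → ℚ) : ℚ :=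
  blockProd (Finset.Icc 1 p) lam * blockProd (Finset.Icc (p + 1) (p + q)) lam

/-- The Weyl dimension polynomial `P_{K∩L}`, a product over the five index blocks
`{1,…,k}`, `{k+1,…,p}`, `{p+1,…,2p−k}`, `{2p−k+1,…,p+q−k}`, `{p+q−k+1,…,p+q}`. -/
def PKL (p q k : ℕ) (lam : ℕ → ℚ) : ℚ :=
  blockProd (Finset.Icc 1 k) lam * blockProd (Finset.Icc (k + 1) p) lam *
    blockProd (Finset.Icc (p + 1) (2 * p - k)) lam *
    blockProd (Finset.Icc (2 * p - k + 1) (p + q - k)) lam *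
    blockProd (Finset.Icc (p + q - k + 1) (p + q)) lam

/-- The vector `e_i − e_j` in `ℚ^n` (indices written `1,…,n`). -/
def root (i j : ℕ) : ℕ → ℚ := fun t => (if t = i then (1 : ℚ) else 0) - (if t = j then 1 else 0)

/-- `σ(S) = ∑_{β ∈ S} β`, where the finite set `S` of vectors `e_i − e_j` is encoded by the
finite set of the corresponding pairs `(i, j)`. -/
def sigmaSum (S : Finset (ℕ × ℕ)) : ℕ → ℚ := fun t => ∑ ij ∈ S, root ij.1 ij.2 t

/-- `Δ_n^+(𝔩) = {e_i − e_j : 1 ≤ i ≤ k, p+1 ≤ j ≤ 2p−k} ∪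
{e_i − e_j : k+1 ≤ i ≤ p, p+q−k+1 ≤ j ≤ p+q}`, encoded by pairs of indices. -/
def DeltaNL (p q k : ℕ) : Finset (ℕ × ℕ) :=
  (Finset.Icc 1 k ×ˢ Finset.Icc (p + 1) (2 * p - k)) ∪
    (Finset.Icc (k + 1) p ×ˢ Finset.Icc (p + q - k + 1) (p + q))

/-- `Δ(𝔭_1) = {e_i − e_j : 1 ≤ i ≤ k, 2p−k+1 ≤ j ≤ p+q−k} ∪
{e_i − e_j : 2p−k+1 ≤ i ≤ p+q−k, k+1 ≤ j ≤ p}`, encoded by pairs of indices. -/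
def DeltaP1 (p q k : ℕ) : Finset (ℕ × ℕ) :=
  (Finset.Icc 1 k ×ˢ Finset.Icc (2 * p - k + 1) (p + q - k)) ∪
    (Finset.Icc (2 * p - k + 1) (p + q - k) ×ˢ Finset.Icc (k + 1) p)

/-- The special point
`λ_0 = (q, q−1, …, q−k+1, p, p−1, …, k+1 | p−k, …, 1, q−k, …, p−k+1, k, …, 1)`. -/
def lam0 (p q k : ℕ) : ℕ → ℚ := fun t =>
  if t ≤ k then (q : ℚ) + 1 - t
  else if t ≤ p then (p : ℚ) + k + 1 - t
  else if t ≤ 2 * p - k then 2 * (p : ℚ) - k + 1 - t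
  else if t ≤ p + q - k then (q : ℚ) + 2 * p - 2 * k + 1 - t
  else (p : ℚ) + q + 1 - t

/-- The alternating double sum
`∑_{A ⊆ Δ_n^+(𝔩)} ∑_{C ⊆ Δ(𝔭_1)} (−1)^{|A|+|C|} P_K(λ − σ(A) − σ(C))`. -/
def DSum (p q k : ℕ) (lam : ℕ → ℚ) : ℚ :=
  ∑ A ∈ (DeltaNL p q k).powerset, ∑ C ∈ (DeltaP1 p q k).powerset,
    (-1 : ℚ) ^ (A.card + C.card) *
      PK p q (fun t => lam t - sigmaSum A t - sigmaSum C t)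

section ColoredVandermonde

open MvPolynomial

variable {n : ℕ}

/-- The pairs `i < j` of indices of equal color. -/
def samePairs (c : Fin n → ℕ) : Finset (Fin n × Fin n) :=
  univ.filter fun e => e.1 < e.2 ∧ c e.1 = c e.2

/-- The product of the Vandermonde products of the color classes. -/
def vand {R : Type*} [CommRing R] (c : Fin n → ℕ) (x : Fin n → R) : R :=
  ∏ e ∈ samePairs c, (x e.1 - x e.2)

/-- The color-preserving permutations. -/
def colorPerms (c : Fin n → ℕ) : Finset (Equiv.Perm (Fin n)) :=
  univ.filter fun w => ∀ i, c (w i) = c i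

/-- The exponent vector of the leading monomial of `vand c`. -/
def rho (c : Fin n → ℕ) (i : Fin n) : ℕ := #{j | i < j ∧ c i = c j}

theorem mem_colorPerms {c : Fin n → ℕ} {w : Equiv.Perm (Fin n)} :
    w ∈ colorPerms c ↔ ∀ i, c (w i) = c i := by
  simp [colorPerms]

theorem one_mem_colorPerms (c : Fin n → ℕ) : 1 ∈ colorPerms c := by
  simp [mem_colorPerms]

theorem mul_mem_colorPerms {c : Fin n → ℕ} {v w : Equiv.Perm (Fin n)}
    (hv : v ∈ colorPerms c) (hw : w ∈ colorPerms c) : v * w ∈ colorPerms c := by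
  rw [mem_colorPerms] at *
  intro i
  rw [Equiv.Perm.mul_apply, hv, hw]

theorem inv_mem_colorPerms {c : Fin n → ℕ} {w : Equiv.Perm (Fin n)}
    (hw : w ∈ colorPerms c) : w⁻¹ ∈ colorPerms c := by
  rw [mem_colorPerms] at *
  intro i
  rw [← hw]
  exact congrArg c (w.apply_symm_apply i)

theorem sum_colorPerms_mul_right {M : Type*} [AddCommMonoid M] {c : Fin n → ℕ}
    {v : Equiv.Perm (Fin n)} (hv : v ∈ colorPerms c) (f : Equiv.Perm (Fin n) → M) :
    ∑ w ∈ colorPerms c, f (w * v) = ∑ w ∈ colorPerms c, f w :=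
  sum_nbij' (· * v) (· * v⁻¹) (fun _ hw => mul_mem_colorPerms hw hv)
    (fun _ hw => mul_mem_colorPerms hw (inv_mem_colorPerms hv)) (by simp) (by simp) (by simp)

theorem sum_colorPerms_mul_left {M : Type*} [AddCommMonoid M] {c : Fin n → ℕ}
    {v : Equiv.Perm (Fin n)} (hv : v ∈ colorPerms c) (f : Equiv.Perm (Fin n) → M) :
    ∑ w ∈ colorPerms c, f (v * w) = ∑ w ∈ colorPerms c, f w :=
  sum_nbij' (v * ·) (v⁻¹ * ·) (fun _ hw => mul_mem_colorPerms hv hw)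
    (fun _ hw => mul_mem_colorPerms (inv_mem_colorPerms hv) hw) (by simp) (by simp) (by simp)

theorem sum_colorPerms_inv {M : Type*} [AddCommMonoid M] {c : Fin n → ℕ}
    (f : Equiv.Perm (Fin n) → M) :
    ∑ w ∈ colorPerms c, f w⁻¹ = ∑ w ∈ colorPerms c, f w :=
  sum_nbij' (·⁻¹) (·⁻¹) (fun _ hw => inv_mem_colorPerms hw)
    (fun _ hw => inv_mem_colorPerms hw) (by simp) (by simp) (by simp)

theorem prod_samePairs {M : Type*} [CommMonoid M] (c : Fin n → ℕ) (g : Fin n → Fin n → M) :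
    ∏ e ∈ samePairs c, g e.1 e.2 = ∏ i, ∏ j, if i < j ∧ c i = c j then g i j else 1 := by
  rw [samePairs, prod_filter, ← univ_product_univ, prod_product]

theorem vand_comp {R : Type*} [CommRing R] {c : Fin n → ℕ} {w : Equiv.Perm (Fin n)}
    (hw : w ∈ colorPerms c) (x : Fin n → R) :
    vand c (x ∘ w) = ((w.sign : ℤ) : R) * vand c x := by
  rw [mem_colorPerms] at hw
  set s : Fin n → Fin n → R := fun i j => if c i = c j then 1 else if c i < c j then 1 else -1
    with hs
  set E : R := ∏ j, ∏ i ∈ Iio j, s i j with hE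
  have hEE : E * E = 1 := by
    rw [hE, ← prod_mul_distrib]
    refine prod_eq_one fun j _ => ?_
    rw [← prod_mul_distrib]
    refine prod_eq_one fun i _ => ?_
    simp only [hs]
    split_ifs <;> simp
  have key : ∀ y : Fin n → R,
      vand c y * E = ∏ j, ∏ i ∈ Iio j, if c i = c j then y i - y j else s i j := by
    intro y
    rw [vand, prod_samePairs c (fun i j => y i - y j), prod_comm, hE, ← prod_mul_distrib]
    refine prod_congr rfl fun j _ => ?_
    have : ∏ i, (if i < j ∧ c i = c j then y i - y j else 1) =
        ∏ i ∈ Iio j, if c i = c j then y i - y j else 1 := by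
      rw [← filter_gt_eq_Iio, prod_filter]
      refine prod_congr rfl fun i _ => ?_
      by_cases h : i < j <;> simp [h]
    rw [this, ← prod_mul_distrib]
    refine prod_congr rfl fun i _ => ?_
    simp only [hs]
    split_ifs <;> simp
  have h := w.prod_Iio_comp_eq_sign_mul_prod
    (f := fun i j => if c i = c j then x i - x j else s i j) (by
      intro i j
      simp only [hs]
      rcases lt_trichotomy (c i) (c j) with h | h | h
      · simp [h.ne, h.ne', h, h.not_gt]
      · simp [h]
      · simp [h.ne, h.ne', h, h.le])
  rw [← key] at h
  have h2 : ∏ j, ∏ i ∈ Iio j, (if c (w i) = c (w j) then x (w i) - x (w j) else s (w i) (w j)) =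
      vand c (x ∘ w) * E := by
    rw [key]
    simp only [hs, hw, Function.comp]
  rw [h2] at h
  calc vand c (x ∘ w) = vand c (x ∘ w) * E * E := by rw [mul_assoc, hEE, mul_one]
    _ = _ := by rw [h, mul_assoc, mul_assoc, hEE, mul_one]

theorem sum_rho (c : Fin n → ℕ) : ∑ i, rho c i = #(samePairs c) := by
  simp only [rho, samePairs, card_filter]
  rw [← univ_product_univ, sum_product]

theorem rho_lt {c : Fin n → ℕ} {i j : Fin n} (hij : i < j) (h : c i = c j) :
    rho c j < rho c i := by
  refine card_lt_card (Finset.ssubset_iff_of_subset ?_ |>.2 ⟨j, by simp [hij, h], by simp⟩)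
  intro t
  simp only [mem_filter_univ, h]
  exact fun ht => ⟨hij.trans ht.1, ht.2⟩

theorem rho_injective {c : Fin n → ℕ} {i j : Fin n} (h : c i = c j)
    (hr : rho c i = rho c j) : i = j := by
  rcases lt_trichotomy i j with hij | hij | hij
  · exact absurd hr (rho_lt hij h).ne'
  · exact hij
  · exact absurd hr (rho_lt hij h.symm).ne

theorem eq_one_of_rho_comp_le {c : Fin n → ℕ} {w : Equiv.Perm (Fin n)} (hw : w ∈ colorPerms c)
    (h : ∀ i, rho c (w i) ≤ rho c i) : w = 1 := by
  have hs : ∑ i, rho c (w i) = ∑ i, rho c i := Equiv.sum_comp w (rho c)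
  have := (sum_eq_sum_iff_of_le fun i _ => h i).1 hs
  ext1 i
  exact rho_injective (mem_colorPerms.1 hw i) (this i (mem_univ i))

theorem exists_eq_rho_comp {c a : Fin n → ℕ} (ha : ∀ i j, c i = c j → a i = a j → i = j)
    (hle : ∑ i, a i ≤ ∑ i, rho c i) : ∃ w ∈ colorPerms c, a = rho c ∘ w := by
  set r : Fin n → ℕ := fun i => #{j | c j = c i ∧ a j < a i} with hr
  have hra : ∀ i, r i ≤ a i := by
    intro i
    have : #{j | c j = c i ∧ a j < a i} ≤ #(range (a i)) :=
      card_le_card_of_injOn a (by intro j; simp) (by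
        intro j hj t ht h
        simp at hj ht
        exact ha j t (hj.1.trans ht.1.symm) h)
    simpa using this
  have hsum : ∑ i, r i = ∑ i, rho c i := by
    have h1 : ∑ i, r i = #{e : Fin n × Fin n | c e.2 = c e.1 ∧ a e.2 < a e.1} := by
      simp only [hr, card_filter]
      rw [← univ_product_univ, sum_product]
    rw [h1, sum_rho]
    refine card_nbij' (fun e => if e.1 < e.2 then e else e.swap)
      (fun e => if a e.2 < a e.1 then e else e.swap) ?_ ?_ ?_ ?_
    · rintro ⟨i, j⟩ h
      simp only [samePairs, coe_filter, mem_univ, true_and, Set.mem_ofPred_eq] at h ⊢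
      split_ifs with hij
      · exact ⟨hij, h.1.symm⟩
      · have : i ≠ j := by rintro rfl; exact lt_irrefl _ h.2
        exact ⟨lt_of_le_of_ne (not_lt.1 hij) this.symm, h.1⟩
    · rintro ⟨i, j⟩ h
      simp only [samePairs, coe_filter, mem_univ, true_and, Set.mem_ofPred_eq] at h ⊢
      split_ifs with hij
      · exact ⟨h.2.symm, hij⟩
      · have : a i ≠ a j := fun h' => h.1.ne (ha _ _ h.2 h')
        exact ⟨h.2, lt_of_le_of_ne (not_lt.1 hij) this⟩
    · rintro ⟨i, j⟩ h
      simp only [coe_filter, mem_univ, true_and, Set.mem_ofPred_eq] at h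
      by_cases hij : i < j <;> simp [hij, h.2, h.2.le]
    · rintro ⟨i, j⟩ h
      simp only [samePairs, coe_filter, mem_univ, true_and, Set.mem_ofPred_eq] at h
      by_cases hij : a j < a i <;> simp [hij, h.1, h.1.le]
  have hreq : ∀ i, r i = a i := by
    have : ∑ i, r i = ∑ i, a i :=
      le_antisymm (sum_le_sum fun i _ => hra i) (hle.trans_eq hsum.symm)
    exact fun i => (sum_eq_sum_iff_of_le fun i _ => hra i).1 this i (mem_univ i)
  have hex : ∀ i, ∃ j, c j = c i ∧ rho c j = a i := by
    intro i
    set B : Finset (Fin n) := {j | c j = c i} with hB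
    have hmap : Set.MapsTo (rho c) B (range #B) := by
      intro j hj
      simp only [hB, coe_filter, mem_univ, true_and, Set.mem_ofPred_eq] at hj
      simp only [coe_range, Set.mem_Iio, rho]
      refine card_lt_card (Finset.ssubset_iff_of_subset ?_ |>.2 ⟨j, by simp [hB, hj], by simp⟩)
      intro t
      simp only [mem_filter_univ, hB]
      exact fun ht => ht.2.symm.trans hj
    have hinj : Set.InjOn (rho c) B := by
      intro j hj t ht h
      simp only [hB, coe_filter, mem_univ, true_and, Set.mem_ofPred_eq] at hj ht
      exact rho_injective (hj.trans ht.symm) h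
    have hsurj := surjOn_of_injOn_of_card_le (rho c) hmap hinj (by simp)
    have hai : a i ∈ (range #B : Set ℕ) := by
      rw [← hreq]
      simp only [coe_range, Set.mem_Iio, hr]
      refine card_lt_card (Finset.ssubset_iff_of_subset ?_ |>.2 ⟨i, by simp [hB], by simp⟩)
      intro t
      simp only [mem_filter_univ, hB]
      exact fun ht => ht.1
    obtain ⟨j, hj, hj'⟩ := hsurj hai
    exact ⟨j, by simpa [hB] using hj, hj'⟩
  choose w hw hw' using hex
  have hinj : Function.Injective w := by
    intro i j h
    exact ha i j (by rw [← hw i, ← hw j, h]) (by rw [← hw' i, ← hw' j, h])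
  refine ⟨Equiv.ofBijective w (Finite.injective_iff_bijective.1 hinj), ?_, ?_⟩
  · simpa [mem_colorPerms] using hw
  · funext i
    simp [hw']

/-- A function of exponent vectors that is antisymmetric under the color-preserving
permutations. -/
def IsColorAntisymm (c : Fin n → ℕ) (f : (Fin n → ℕ) → ℚ) : Prop :=
  ∀ w ∈ colorPerms c, ∀ a, f (a ∘ w) = ((w.sign : ℤ) : ℚ) * f a

theorem IsColorAntisymm.mul_apply_rho {c : Fin n → ℕ} {f g : (Fin n → ℕ) → ℚ}
    (hf : IsColorAntisymm c f) (hg : IsColorAntisymm c g) {a : Fin n → ℕ}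
    (hle : ∑ i, a i ≤ ∑ i, rho c i) : f a * g (rho c) = g a * f (rho c) := by
  by_cases ha : ∀ i j, c i = c j → a i = a j → i = j
  · obtain ⟨w, hw, rfl⟩ := exists_eq_rho_comp ha hle
    rw [hf w hw, hg w hw]
    ring
  · push Not at ha
    obtain ⟨i, j, hc, hij, hne⟩ := ha
    have hmem : Equiv.swap i j ∈ colorPerms c := by
      rw [mem_colorPerms]
      intro t
      rcases eq_or_ne t i with rfl | hti
      · simp [hc]
      rcases eq_or_ne t j with rfl | htj
      · simp [hc]
      · rw [Equiv.swap_apply_of_ne_of_ne hti htj]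
    have hcomp : a ∘ Equiv.swap i j = a := by
      funext t
      rcases eq_or_ne t i with rfl | hti
      · simp [hij]
      rcases eq_or_ne t j with rfl | htj
      · simp [hij]
      · simp [Equiv.swap_apply_of_ne_of_ne hti htj]
    have hzero : ∀ h : (Fin n → ℕ) → ℚ, IsColorAntisymm c h → h a = 0 := by
      intro h hh
      have := hh _ hmem a
      rw [hcomp, Equiv.Perm.sign_swap hne] at this
      push_cast at this
      linarith
    rw [hzero f hf, hzero g hg, zero_mul, zero_mul]

/-- The exponent vector with the given coordinates. -/
noncomputable def toExp (a : Fin n → ℕ) : Fin n →₀ ℕ := Finsupp.equivFunOnFinite.symm a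

@[simp]
theorem toExp_apply (a : Fin n → ℕ) (i : Fin n) : toExp a i = a i := rfl

theorem toExp_coe (s : Fin n →₀ ℕ) : toExp s = s := by
  ext i
  rfl

theorem mapDomain_toExp_comp (a : Fin n → ℕ) (w : Equiv.Perm (Fin n)) :
    (toExp (a ∘ w)).mapDomain w = toExp a := by
  ext i
  obtain ⟨j, rfl⟩ := w.surjective i
  rw [Finsupp.mapDomain_apply w.injective]
  rfl

theorem coeff_rename_perm (F : MvPolynomial (Fin n) ℚ) (w : Equiv.Perm (Fin n))
    (a : Fin n → ℕ) : coeff (toExp a) (rename w F) = coeff (toExp (a ∘ w)) F := by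
  rw [← mapDomain_toExp_comp a w, coeff_rename_mapDomain _ w.injective]

theorem isColorAntisymm_coeff {c : Fin n → ℕ} {F : MvPolynomial (Fin n) ℚ}
    (h : ∀ w ∈ colorPerms c, rename w F = C ((w.sign : ℤ) : ℚ) * F) :
    IsColorAntisymm c fun a => coeff (toExp a) F := by
  intro w hw a
  dsimp only
  rw [← coeff_rename_perm, h w hw, coeff_C_mul]

theorem map_vand {R S G : Type*} [CommRing R] [CommRing S] [FunLike G R S] [RingHomClass G R S]
    (φ : G) (c : Fin n → ℕ) (x : Fin n → R) : φ (vand c x) = vand c (φ ∘ x) := by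
  simp [vand, map_prod]

theorem rename_vand {c : Fin n → ℕ} {w : Equiv.Perm (Fin n)} (hw : w ∈ colorPerms c) :
    rename w (vand c X : MvPolynomial (Fin n) ℚ) = C ((w.sign : ℤ) : ℚ) * vand c X := by
  have h : (rename w : MvPolynomial (Fin n) ℚ →ₐ[ℚ] _) ∘ X = X ∘ w := by
    funext i
    simp
  rw [map_vand, h, vand_comp hw]
  simp

theorem eval_vand (c : Fin n → ℕ) (x : Fin n → ℚ) : eval x (vand c X) = vand c x := by
  rw [map_vand]
  congr 1
  funext i
  simp

theorem totalDegree_prod_sub_le {ι : Type*} (S : Finset ι) (f g : ι → Fin n) :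
    (∏ e ∈ S, (X (f e) - X (g e)) : MvPolynomial (Fin n) ℚ).totalDegree ≤ #S := by
  refine (totalDegree_finsetProd _ _).trans ?_
  rw [card_eq_sum_ones]
  refine sum_le_sum fun e _ => (totalDegree_sub _ _).trans ?_
  simp

theorem coeff_prod_sub_of_lt (S : Finset (Fin n × Fin n)) (hS : ∀ e ∈ S, e.1 < e.2) :
    coeff (∑ e ∈ S, Finsupp.single e.1 1)
      (∏ e ∈ S, (X e.1 - X e.2) : MvPolynomial (Fin n) ℚ) = 1 := by
  rw [prod_sub, coeff_sum, sum_eq_single ∅]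
  · simp [X, ← monomial_sum_one]
  · intro t ht hne
    rw [mem_powerset] at ht
    have : (-1 : MvPolynomial (Fin n) ℚ) ^ #t = C ((-1) ^ #t) := by simp
    rw [this, mul_assoc, coeff_C_mul]
    simp only [X, ← monomial_sum_one, monomial_mul, mul_one]
    rw [coeff_monomial, if_neg, mul_zero]
    intro h
    have hw := congrArg (Finsupp.weight fun i : Fin n => (i : ℕ)) h
    simp only [map_add, map_sum, Finsupp.weight_single, smul_eq_mul, one_mul] at hw
    rw [← sum_sdiff ht] at hw
    have : ∑ e ∈ t, (e.1 : ℕ) < ∑ e ∈ t, (e.2 : ℕ) :=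
      sum_lt_sum_of_nonempty (nonempty_iff_ne_empty.2 hne) fun e he => hS e (ht he)
    omega
  · simp

theorem toExp_rho (c : Fin n → ℕ) :
    toExp (rho c) = ∑ e ∈ samePairs c, Finsupp.single e.1 1 := by
  ext i
  rw [Finsupp.finsetSum_apply, samePairs, sum_filter, ← univ_product_univ, sum_product,
    sum_eq_single i]
  · rw [toExp_apply, rho, card_filter]
    simp [ite_and]
  · intro j _ hj
    simp [hj]
  · simp

theorem coeff_rho_vand (c : Fin n → ℕ) :
    coeff (toExp (rho c)) (vand c X : MvPolynomial (Fin n) ℚ) = 1 := by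
  rw [toExp_rho, vand, coeff_prod_sub_of_lt]
  simp [samePairs]
  tauto

theorem totalDegree_vand_le (c : Fin n → ℕ) :
    (vand c X : MvPolynomial (Fin n) ℚ).totalDegree ≤ ∑ i, rho c i := by
  rw [sum_rho]
  exact totalDegree_prod_sub_le _ _ _

theorem sum_sign_eval_comp {c : Fin n → ℕ} {F : MvPolynomial (Fin n) ℚ}
    (hF : F.totalDegree ≤ ∑ i, rho c i) (x : Fin n → ℚ) :
    ∑ w ∈ colorPerms c, ((w.sign : ℤ) : ℚ) * eval (x ∘ w) F =
      (∑ w ∈ colorPerms c, ((w.sign : ℤ) : ℚ) * coeff (toExp (rho c ∘ w)) F) * vand c x := by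
  set A : MvPolynomial (Fin n) ℚ :=
    ∑ w ∈ colorPerms c, C ((w.sign : ℤ) : ℚ) * rename w F with hA
  have hAanti : ∀ v ∈ colorPerms c, rename v A = C ((v.sign : ℤ) : ℚ) * A := by
    intro v hv
    have hsq : C ((v.sign : ℤ) : ℚ) * C ((v.sign : ℤ) : ℚ) = (1 : MvPolynomial (Fin n) ℚ) := by
      rw [← C_mul, ← Int.cast_mul, Int.units_coe_mul_self, Int.cast_one, C_1]
    have hA' : A = ∑ w ∈ colorPerms c, C (((v * w).sign : ℤ) : ℚ) * rename (v * w) F :=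
      (sum_colorPerms_mul_left hv fun w => C ((w.sign : ℤ) : ℚ) * rename w F).symm
    rw [hA', mul_sum, ← hA', hA, map_sum]
    refine sum_congr rfl fun w _ => ?_
    rw [map_mul, rename_C, rename_rename, Equiv.Perm.sign_mul, Units.val_mul, Int.cast_mul, C_mul,
      ← mul_assoc, ← mul_assoc, hsq, one_mul, Equiv.Perm.coe_mul]
  have hAcoeff : ∀ a, coeff (toExp a) A =
      ∑ w ∈ colorPerms c, ((w.sign : ℤ) : ℚ) * coeff (toExp (a ∘ w)) F := by
    intro a
    simp only [hA, coeff_sum, coeff_C_mul, coeff_rename_perm]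
  have hAdeg : A.totalDegree ≤ ∑ i, rho c i := by
    refine totalDegree_finsetSum_le fun w _ => (totalDegree_mul _ _).trans ?_
    rw [totalDegree_C, zero_add]
    exact (totalDegree_rename_le _ _).trans hF
  have hAV : A = C (coeff (toExp (rho c)) A) * vand c X := by
    ext s
    rw [← toExp_coe s, coeff_C_mul]
    by_cases hs : ∑ i, s i ≤ ∑ i, rho c i
    · have := (isColorAntisymm_coeff hAanti).mul_apply_rho
        (isColorAntisymm_coeff fun w hw => rename_vand hw) hs
      rw [coeff_rho_vand, mul_one] at this
      rw [this, mul_comm]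
    · have hlt : ∑ i, rho c i < ∑ i ∈ s.support, s i := by
        rw [sum_subset (subset_univ s.support) (by simp)]
        exact not_le.1 hs
      rw [toExp_coe, coeff_eq_zero_of_totalDegree_lt (hAdeg.trans_lt hlt),
        coeff_eq_zero_of_totalDegree_lt ((totalDegree_vand_le c).trans_lt hlt), mul_zero]
  have := congrArg (eval x) hAV
  rw [map_mul, eval_C, eval_vand, hAcoeff] at this
  rw [← this, hA, map_sum]
  refine sum_congr rfl fun w _ => ?_
  rw [map_mul, eval_C, eval_rename]

/-- The binomial coefficient `x (x - 1) ⋯ (x - s + 1) / s!`. -/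
def bin (x : ℚ) (s : ℕ) : ℚ := (∏ r ∈ range s, (x - r)) / s.factorial

@[simp]
theorem bin_zero (x : ℚ) : bin x 0 = 1 := by simp [bin]

theorem bin_add_one (x : ℚ) (s : ℕ) : bin (x + 1) (s + 1) = bin x (s + 1) + bin x s := by
  have h1 : ∏ r ∈ range (s + 1), (x + 1 - (r : ℚ)) = (x + 1) * ∏ r ∈ range s, (x - r) := by
    rw [prod_range_succ', mul_comm]
    congr 1
    · simp
    · refine prod_congr rfl fun r _ => ?_
      push_cast
      ring
  rw [bin, bin, bin, h1, prod_range_succ, Nat.factorial_succ]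
  have : (s.factorial : ℚ) ≠ 0 := by positivity
  push_cast
  field_simp
  ring

theorem bin_natCast_of_lt {m s : ℕ} (h : m < s) : bin m s = 0 := by
  rw [bin, prod_eq_zero (mem_range.2 h) (sub_self _), zero_div]

theorem bin_natCast_self (m : ℕ) : bin m m = 1 := by
  induction m with
  | zero => simp
  | succ m ih =>
    push_cast
    rw [bin_add_one, ih, bin_natCast_of_lt m.lt_succ_self, zero_add]

/-- The normalized Vandermonde product, as an alternating sum of products of binomial
coefficients. -/
def weyl (c : Fin n → ℕ) (x : Fin n → ℚ) : ℚ :=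
  ∑ w ∈ colorPerms c, ((w.sign : ℤ) : ℚ) * ∏ i, bin (x i) (rho c (w i))

theorem weyl_rho (c : Fin n → ℕ) : weyl c (fun i => rho c i) = 1 := by
  rw [weyl, sum_eq_single 1]
  · simp [bin_natCast_self]
  · intro w hw hne
    obtain ⟨i, hi⟩ : ∃ i, rho c i < rho c (w i) := by
      by_contra! h
      exact hne (eq_one_of_rho_comp_le hw h)
    rw [prod_eq_zero (mem_univ i) (bin_natCast_of_lt hi), mul_zero]
  · exact fun h => absurd (one_mem_colorPerms c) h

theorem weyl_mul_vand_rho (c : Fin n → ℕ) (x : Fin n → ℚ) :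
    weyl c x * vand c (fun i => (rho c i : ℚ)) = vand c x := by
  set F : MvPolynomial (Fin n) ℚ :=
    ∏ i, (∏ r ∈ range (rho c i), (X i - C (r : ℚ))) * C (((rho c i).factorial : ℚ)⁻¹) with hF
  have hdeg : F.totalDegree ≤ ∑ i, rho c i := by
    refine (totalDegree_finsetProd _ _).trans (sum_le_sum fun i _ => ?_)
    refine (totalDegree_mul _ _).trans ?_
    rw [totalDegree_C, add_zero]
    refine (totalDegree_finsetProd _ _).trans ?_
    conv_rhs => rw [← card_range (rho c i), card_eq_sum_ones]
    refine sum_le_sum fun r _ => (totalDegree_sub _ _).trans ?_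
    rw [totalDegree_C, totalDegree_X, max_eq_left zero_le_one]
  have key : ∀ y : Fin n → ℚ, weyl c y =
      (∑ w ∈ colorPerms c, ((w.sign : ℤ) : ℚ) * coeff (toExp (rho c ∘ w)) F) * vand c y := by
    intro y
    rw [← sum_sign_eval_comp hdeg, weyl, ← sum_colorPerms_inv]
    refine sum_congr rfl fun w _ => ?_
    rw [Equiv.Perm.sign_inv, ← Equiv.prod_comp w]
    simp [hF, bin, div_eq_mul_inv]
  have h1 := key fun i => rho c i
  rw [weyl_rho] at h1
  rw [key, mul_right_comm, ← h1, one_mul]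

/-- The power series `∏ i, (1 + X i) ^ x i`. -/
def binSeries (x : Fin n → ℚ) : MvPowerSeries (Fin n) ℚ := fun s => ∏ i, bin (x i) (s i)

theorem coeff_binSeries (x : Fin n → ℚ) (s : Fin n →₀ ℕ) :
    MvPowerSeries.coeff s (binSeries x) = ∏ i, bin (x i) (s i) := rfl

theorem binSeries_add_single (x : Fin n → ℚ) (j : Fin n) :
    binSeries (x + Pi.single j 1) = (1 + MvPowerSeries.X j) * binSeries x := by
  ext s
  rw [add_mul, one_mul, map_add, MvPowerSeries.X_def, MvPowerSeries.coeff_monomial_mul,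
    coeff_binSeries, coeff_binSeries, one_mul, coeff_binSeries,
    ← mul_prod_erase univ _ (mem_univ j), ← mul_prod_erase univ (fun i => bin (x i) (s i))
      (mem_univ j), ← mul_prod_erase univ _ (mem_univ j)]
  have h1 : ∏ i ∈ univ.erase j, bin ((x + Pi.single j 1 : Fin n → ℚ) i) (s i) =
      ∏ i ∈ univ.erase j, bin (x i) (s i) :=
    prod_congr rfl fun i hi => by simp [Pi.single_eq_of_ne (ne_of_mem_erase hi)]
  have h2 : ∏ i ∈ univ.erase j, bin (x i) ((s - Finsupp.single j 1 : Fin n →₀ ℕ) i) =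
      ∏ i ∈ univ.erase j, bin (x i) (s i) :=
    prod_congr rfl fun i hi => by
      simp [Finsupp.single_eq_of_ne (ne_of_mem_erase hi)]
  rw [h1, h2]
  simp only [Pi.add_apply, Pi.single_eq_same, Finsupp.tsub_apply, Finsupp.single_eq_same,
    Finsupp.single_le_iff]
  rcases h : s j with _ | m
  · simp
  · simp [bin_add_one, add_mul]

theorem coeff_mul_binSeries_comp {Q : MvPolynomial (Fin n) ℚ} {v : Equiv.Perm (Fin n)}
    (hQ : rename v Q = Q) (x : Fin n → ℚ) (a : Fin n → ℕ) :
    MvPowerSeries.coeff (toExp (a ∘ v)) ((Q : MvPowerSeries (Fin n) ℚ) * binSeries x) =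
      ∑ e ∈ HasAntidiagonal.antidiagonal (toExp a), coeff e.1 Q * ∏ i, bin (x i) (e.2 (v i)) := by
  rw [MvPowerSeries.coeff_mul]
  have hl : ∀ s : Fin n →₀ ℕ, toExp (s ∘ v) = s.mapDomain v.symm := by
    intro s
    have := congrArg (Finsupp.mapDomain v.symm) (mapDomain_toExp_comp s v)
    rw [← Finsupp.mapDomain_comp, Equiv.symm_comp_self, Finsupp.mapDomain_id, toExp_coe] at this
    exact this
  have hcomp : ∀ s t : Fin n →₀ ℕ, toExp (s ∘ v) + toExp (t ∘ v) = toExp ((s + t) ∘ v) := by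
    intro s t
    ext i
    simp
  symm
  refine sum_nbij' (fun e => (toExp (e.1 ∘ v), toExp (e.2 ∘ v)))
    (fun e => (e.1.mapDomain v, e.2.mapDomain v)) ?_ ?_ ?_ ?_ ?_
  · rintro ⟨s, t⟩ h
    rw [HasAntidiagonal.mem_antidiagonal] at h ⊢
    dsimp only at h ⊢
    rw [hcomp, h]
    rfl
  · rintro ⟨s, t⟩ h
    rw [HasAntidiagonal.mem_antidiagonal] at h ⊢
    dsimp only at h ⊢
    rw [← Finsupp.mapDomain_add, h, mapDomain_toExp_comp]
  · rintro ⟨s, t⟩ _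
    dsimp only
    rw [mapDomain_toExp_comp, mapDomain_toExp_comp, toExp_coe, toExp_coe]
  · rintro ⟨s, t⟩ _
    dsimp only
    rw [hl, hl, ← Finsupp.mapDomain_comp, ← Finsupp.mapDomain_comp, Equiv.symm_comp_self,
      Finsupp.mapDomain_id, Finsupp.mapDomain_id]
  · rintro ⟨s, t⟩ _
    dsimp only
    rw [coeff_binSeries, MvPolynomial.coeff_coe, ← coeff_rename_perm, hQ, toExp_coe]
    rfl

theorem card_mul_sum_coeff_binSeries {cK cL : Fin n → ℕ} (hW : colorPerms cL ⊆ colorPerms cK)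
    {Q : MvPolynomial (Fin n) ℚ} {N : ℕ} (hQ : Q.IsHomogeneous N)
    (hinv : ∀ v ∈ colorPerms cL, rename v Q = Q)
    (hN : N + ∑ i, rho cL i = ∑ i, rho cK i) (x : Fin n → ℚ) :
    #(colorPerms cL) * ∑ w ∈ colorPerms cK, ((w.sign : ℤ) : ℚ) *
        MvPowerSeries.coeff (toExp (rho cK ∘ w)) ((Q : MvPowerSeries (Fin n) ℚ) * binSeries x) =
      weyl cL x * ∑ w ∈ colorPerms cK, ((w.sign : ℤ) : ℚ) *
        coeff (toExp (rho cK ∘ w)) (Q * vand cL X) := by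
  set g : (Fin n → ℕ) → ℚ := fun a =>
    ∑ v ∈ colorPerms cL, ((v.sign : ℤ) : ℚ) * ∏ i, bin (x i) (a (v i)) with hg
  have hganti : IsColorAntisymm cL g := by
    intro u hu a
    have hsq : ((u.sign : ℤ) : ℚ) * ((u.sign : ℤ) : ℚ) = 1 := by
      rw [← Int.cast_mul, Int.units_coe_mul_self, Int.cast_one]
    simp only [hg]
    rw [← sum_colorPerms_mul_left hu (fun v => ((v.sign : ℤ) : ℚ) * ∏ i, bin (x i) (a (v i))),
      mul_sum]
    refine sum_congr rfl fun v _ => ?_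
    rw [Equiv.Perm.sign_mul, Units.val_mul, Int.cast_mul, ← mul_assoc, ← mul_assoc, hsq, one_mul]
    rfl
  have hgV : ∀ a : Fin n → ℕ, ∑ i, a i ≤ ∑ i, rho cL i →
      g a = weyl cL x * coeff (toExp a) (vand cL X) := by
    intro a ha
    have := hganti.mul_apply_rho (isColorAntisymm_coeff fun w hw => rename_vand hw) ha
    rw [coeff_rho_vand, mul_one] at this
    rw [this, mul_comm]
    rfl
  have key : ∀ a : Fin n → ℕ, ∑ i, a i = ∑ i, rho cK i →
      ∑ v ∈ colorPerms cL, ((v.sign : ℤ) : ℚ) *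
        MvPowerSeries.coeff (toExp (a ∘ v)) ((Q : MvPowerSeries (Fin n) ℚ) * binSeries x) =
      weyl cL x * coeff (toExp a) (Q * vand cL X) := by
    intro a ha
    rw [sum_congr rfl fun v hv => by rw [coeff_mul_binSeries_comp (hinv v hv), mul_sum],
      sum_comm, coeff_mul, mul_sum]
    refine sum_congr rfl fun e he => ?_
    rw [HasAntidiagonal.mem_antidiagonal] at he
    have h1 : ∑ v ∈ colorPerms cL, ((v.sign : ℤ) : ℚ) *
        (coeff e.1 Q * ∏ i, bin (x i) (e.2 (v i))) = coeff e.1 Q * g e.2 := by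
      rw [hg, mul_sum]
      exact sum_congr rfl fun v _ => mul_left_comm _ _ _
    rw [h1]
    by_cases hd : e.1.degree = N
    · have hsum : ∑ i, e.1 i + ∑ i, e.2 i = ∑ i, a i := by
        rw [← sum_add_distrib]
        exact sum_congr rfl fun i _ => DFunLike.congr_fun he i
      rw [Finsupp.degree_eq_sum] at hd
      rw [hgV _ (by omega), toExp_coe, mul_left_comm]
    · rw [hQ.coeff_eq_zero hd]
      ring
  rw [← nsmul_eq_mul, ← sum_const]
  calc _ = ∑ v ∈ colorPerms cL, ∑ w ∈ colorPerms cK, ((w.sign : ℤ) : ℚ) *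
        (((v.sign : ℤ) : ℚ) * MvPowerSeries.coeff (toExp ((rho cK ∘ w) ∘ v))
          ((Q : MvPowerSeries (Fin n) ℚ) * binSeries x)) := by
        refine sum_congr rfl fun v hv => ?_
        rw [← sum_colorPerms_mul_right (hW hv)]
        refine sum_congr rfl fun w _ => ?_
        rw [Equiv.Perm.sign_mul, Units.val_mul, Int.cast_mul, mul_assoc]
        rfl
    _ = _ := by
        rw [sum_comm, mul_sum]
        refine sum_congr rfl fun w _ => ?_
        rw [← mul_sum, key (rho cK ∘ w) (Equiv.sum_comp w (rho cK)), mul_left_comm]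

/-- The pairs of indices whose colors satisfy `P`. -/
def colorPairs (c : Fin n → ℕ) (P : ℕ → ℕ → Prop) [DecidableRel P] :
    Finset (Fin n × Fin n) :=
  univ.filter fun e => P (c e.1) (c e.2)

/-- The pair of natural numbers obtained by numbering indices from `1`. -/
def succPair : Fin n × Fin n ↪ ℕ × ℕ where
  toFun e := ((e.1 : ℕ) + 1, (e.2 : ℕ) + 1)
  inj' := by
    rintro ⟨a, b⟩ ⟨a', b'⟩ h
    simpa [Fin.ext_iff] using h

theorem succPair_apply (e : Fin n × Fin n) : succPair e = ((e.1 : ℕ) + 1, (e.2 : ℕ) + 1) := rfl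

/-- The number of pairs in `T` with first entry `i`. -/
def leadCount (T : Finset (Fin n × Fin n)) (i : Fin n) : ℚ := ∑ e ∈ T, if i = e.1 then 1 else 0

theorem sum_powerset_binSeries (T : Finset (Fin n × Fin n)) (x : Fin n → ℚ) :
    ∑ A ∈ (T.map succPair).powerset,
        (-1 : ℚ) ^ #A • binSeries (fun i => x i - sigmaSum A ((i : ℕ) + 1)) =
      ((∏ e ∈ T, (X e.1 - X e.2) : MvPolynomial (Fin n) ℚ) : MvPowerSeries (Fin n) ℚ) *
        binSeries (fun i => x i - leadCount T i) := by
  induction T using Finset.induction_on generalizing x with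
  | empty => simp [sigmaSum, leadCount]
  | insert e T he ih =>
    have he' : succPair e ∉ T.map succPair := by simpa using he
    rw [map_insert, sum_powerset_insert he', ih]
    have h2 : ∑ A ∈ (T.map succPair).powerset, (-1 : ℚ) ^ #(insert (succPair e) A) •
          binSeries (fun i => x i - sigmaSum (insert (succPair e) A) ((i : ℕ) + 1)) =
        -∑ A ∈ (T.map succPair).powerset, (-1 : ℚ) ^ #A •
          binSeries (fun i => (x i - ((if i = e.1 then 1 else 0) - if i = e.2 then 1 else 0)) -
            sigmaSum A ((i : ℕ) + 1)) := by
      rw [← sum_neg_distrib]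
      refine sum_congr rfl fun A hA => ?_
      have hA' : succPair e ∉ A := fun h => he' (mem_powerset.1 hA h)
      rw [card_insert_of_notMem hA', pow_succ, mul_neg_one, neg_smul]
      congr 3
      funext i
      simp only [sigmaSum]
      rw [sum_insert hA', ← sub_sub]
      simp [root, succPair_apply, Fin.ext_iff]
    rw [h2, ih]
    set z : Fin n → ℚ := fun i => x i - leadCount (insert e T) i with hz
    have hz1 : (fun i => x i - leadCount T i) = z + Pi.single e.1 1 := by
      funext i
      simp only [hz, leadCount, sum_insert he, Pi.add_apply, Pi.single_apply]
      ring
    have hz2 : (fun i => (x i - ((if i = e.1 then 1 else 0) - if i = e.2 then 1 else 0)) -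
        leadCount T i) = z + Pi.single e.2 1 := by
      funext i
      simp only [hz, leadCount, sum_insert he, Pi.add_apply, Pi.single_apply]
      ring
    rw [hz1, hz2, binSeries_add_single, binSeries_add_single, prod_insert he]
    simp only [← MvPolynomial.coeToMvPowerSeries.ringHom_apply, map_mul, map_sub]
    simp only [MvPolynomial.coeToMvPowerSeries.ringHom_apply, MvPolynomial.coe_X]
    ring

theorem sum_sum_powerset_weyl (c : Fin n → ℕ) (T U : Finset (Fin n × Fin n)) (x : Fin n → ℚ) :
    ∑ A ∈ (T.map succPair).powerset, ∑ B ∈ (U.map succPair).powerset,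
        (-1 : ℚ) ^ (#A + #B) *
          weyl c (fun i => x i - sigmaSum A ((i : ℕ) + 1) - sigmaSum B ((i : ℕ) + 1)) =
      ∑ w ∈ colorPerms c, ((w.sign : ℤ) : ℚ) * MvPowerSeries.coeff (toExp (rho c ∘ w))
        ((((∏ e ∈ T, (X e.1 - X e.2)) * ∏ e ∈ U, (X e.1 - X e.2) : MvPolynomial (Fin n) ℚ) :
            MvPowerSeries (Fin n) ℚ) *
          binSeries (fun i => x i - leadCount T i - leadCount U i)) := by
  set L : MvPowerSeries (Fin n) ℚ →ₗ[ℚ] ℚ :=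
    ∑ w ∈ colorPerms c, ((w.sign : ℤ) : ℚ) • MvPowerSeries.coeff (toExp (rho c ∘ w)) with hL
  have hLw : ∀ y, weyl c y = L (binSeries y) := by
    intro y
    simp [hL, weyl, coeff_binSeries]
  have hLa : ∀ f, ∑ w ∈ colorPerms c, ((w.sign : ℤ) : ℚ) *
      MvPowerSeries.coeff (toExp (rho c ∘ w)) f = L f := by
    intro f
    simp [hL]
  have hswap : (fun i => x i - leadCount T i - leadCount U i) =
      fun i => (x i - leadCount U i) - leadCount T i := by
    funext i
    ring
  rw [hLa, mul_comm (∏ e ∈ T, _), MvPolynomial.coe_mul, mul_assoc, hswap,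
    ← sum_powerset_binSeries, mul_sum, map_sum]
  refine sum_congr rfl fun A _ => ?_
  have hswap' : (fun i : Fin n => x i - leadCount U i - sigmaSum A ((i : ℕ) + 1)) =
      fun i => (x i - sigmaSum A ((i : ℕ) + 1)) - leadCount U i := by
    funext i
    ring
  rw [hswap', mul_smul_comm, ← sum_powerset_binSeries, smul_sum, map_sum]
  refine sum_congr rfl fun B _ => ?_
  rw [hLw, map_smul, map_smul, smul_eq_mul, smul_eq_mul, pow_add, mul_assoc]

theorem leadCount_colorPairs_congr {c : Fin n → ℕ} (P : ℕ → ℕ → Prop) [DecidableRel P]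
    {i j : Fin n} (h : c i = c j) :
    leadCount (colorPairs c P) i = leadCount (colorPairs c P) j := by
  have key : ∀ i, leadCount (colorPairs c P) i = ∑ t, if P (c i) (c t) then 1 else 0 := by
    intro i
    rw [leadCount, colorPairs, sum_filter, ← univ_product_univ, sum_product, sum_eq_single i]
    · simp
    · intro t _ ht
      simp [ht.symm]
    · simp
  rw [key, key, h]

theorem rename_prod_colorPairs {c : Fin n → ℕ} {v : Equiv.Perm (Fin n)} (hv : v ∈ colorPerms c)
    (P : ℕ → ℕ → Prop) [DecidableRel P] :
    rename v (∏ e ∈ colorPairs c P, (X e.1 - X e.2) : MvPolynomial (Fin n) ℚ) =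
      ∏ e ∈ colorPairs c P, (X e.1 - X e.2) := by
  rw [map_prod]
  simp only [map_sub, rename_X]
  have h1 := mem_colorPerms.1 hv
  have h2 := mem_colorPerms.1 (inv_mem_colorPerms hv)
  refine prod_nbij' (fun e => (v e.1, v e.2)) (fun e => (v⁻¹ e.1, v⁻¹ e.2)) ?_ ?_ ?_ ?_ ?_
  · simp [colorPairs, h1]
  · intro e
    simp only [colorPairs, mem_filter_univ, h2, imp_self]
  · simp
  · simp
  · simp

theorem isHomogeneous_prod_sub (T : Finset (Fin n × Fin n)) :
    (∏ e ∈ T, (X e.1 - X e.2) : MvPolynomial (Fin n) ℚ).IsHomogeneous #T := by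
  rw [card_eq_sum_ones]
  exact IsHomogeneous.prod _ _ _ fun e _ => (isHomogeneous_X _ _).sub (isHomogeneous_X _ _)

theorem rho_sub_rho {c : Fin n → ℕ} (hc : Monotone c) {i j : Fin n} (hij : i < j)
    (h : c i = c j) : (rho c i : ℚ) - rho c j = (j : ℚ) - i := by
  have hsplit : rho c i = #(Ioc i j) + rho c j := by
    rw [rho, rho, ← card_union_of_disjoint]
    · congr 1
      ext t
      simp only [mem_filter_univ, mem_union, mem_Ioc]
      constructor
      · rintro ⟨h1, h2⟩
        rcases le_or_gt t j with h3 | h3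
        · exact .inl ⟨h1, h3⟩
        · exact .inr ⟨h3, h.symm.trans h2⟩
      · rintro (⟨h1, h2⟩ | ⟨h1, h2⟩)
        · exact ⟨h1, le_antisymm (hc h1.le) (h ▸ hc h2)⟩
        · exact ⟨hij.trans h1, h.trans h2⟩
    · rw [disjoint_left]
      intro t
      simp only [mem_filter_univ, mem_Ioc]
      rintro ⟨_, h1⟩ ⟨h2, _⟩
      exact absurd h1 h2.not_ge
  rw [hsplit, Fin.card_Ioc, Nat.cast_add, Nat.cast_sub (Fin.le_def.1 hij.le)]
  ring

theorem weyl_eq_prod {c : Fin n → ℕ} (hc : Monotone c) (x : Fin n → ℚ) :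
    weyl c x = ∏ e ∈ samePairs c, (x e.1 - x e.2) / ((e.2 : ℚ) - (e.1 : ℚ)) := by
  have hv : vand c (fun i => (rho c i : ℚ)) = ∏ e ∈ samePairs c, ((e.2 : ℚ) - (e.1 : ℚ)) := by
    refine prod_congr rfl fun e he => ?_
    simp only [samePairs, mem_filter_univ] at he
    exact rho_sub_rho hc he.1 he.2
  rw [prod_div_distrib, ← hv, eq_div_iff, weyl_mul_vand_rho]
  · rfl
  · rw [hv, prod_ne_zero_iff]
    intro e he
    simp only [samePairs, mem_filter_univ] at he
    have : (e.1 : ℚ) < (e.2 : ℚ) := by exact_mod_cast he.1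
    exact (sub_pos.2 this).ne'

theorem weyl_eq_prod_blockProd {c : Fin n → ℕ} (hc : Monotone c) {D : ℕ} (hD : ∀ i, c i < D)
    {B : ℕ → Finset ℕ}
    (hB : ∀ d < D, ∀ t, t ∈ B d ↔ ∃ i : Fin n, (i : ℕ) + 1 = t ∧ c i = d) (lam : ℕ → ℚ) :
    weyl c (fun i => lam ((i : ℕ) + 1)) = ∏ d ∈ range D, blockProd (B d) lam := by
  rw [weyl_eq_prod hc, ← prod_fiberwise_of_maps_to (t := range D) (g := fun e => c e.1)
    fun e _ => mem_range.2 (hD e.1)]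
  refine prod_congr rfl fun d hd => ?_
  have hBd : B d = image (fun i : Fin n => (i : ℕ) + 1) {i | c i = d} := by
    ext t
    rw [hB d (mem_range.1 hd)]
    simp [and_comm]
  have hinj : Set.InjOn (fun i : Fin n => (i : ℕ) + 1) ({i | c i = d} : Finset (Fin n)) := by
    intro i _ j _ h
    simpa [Fin.ext_iff] using h
  rw [blockProd, hBd, prod_image hinj]
  simp only [prod_image hinj]
  rw [samePairs, filter_filter, prod_filter, ← univ_product_univ, prod_product, prod_filter]
  refine prod_congr rfl fun i _ => ?_
  by_cases hi : c i = d
  · rw [if_pos hi, prod_filter]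
    refine prod_congr rfl fun j _ => ?_
    subst hi
    by_cases hj : c j = c i <;> simp [hj, eq_comm (a := c i)]
  · simp [hi]

end ColoredVandermonde

section FiveColors

open MvPolynomial

variable {n : ℕ}

@[to_additive]
theorem prod_colorPairs {M : Type*} [CommMonoid M] {c : Fin n → ℕ} {D : ℕ} (hD : ∀ i, c i < D)
    (P : ℕ → ℕ → Prop) [DecidableRel P] (g : Fin n → Fin n → M) :
    ∏ e ∈ colorPairs c P, g e.1 e.2 = ∏ d ∈ range D, ∏ d' ∈ range D,
      if P d d' then ∏ i with c i = d, ∏ j with c j = d', g i j else 1 := by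
  rw [colorPairs, prod_filter, ← univ_product_univ, prod_product,
    ← prod_fiberwise_of_maps_to (t := range D) (g := c) fun i _ => mem_range.2 (hD i)]
  refine prod_congr rfl fun d _ => ?_
  have h : ∀ i ∈ ({i | c i = d} : Finset (Fin n)),
      (∏ j, if P (c i) (c j) then g i j else 1) =
        ∏ d' ∈ range D, if P d d' then ∏ j with c j = d', g i j else 1 := by
    intro i hi
    rw [mem_filter_univ] at hi
    rw [← prod_fiberwise_of_maps_to (t := range D) (g := c) fun i _ => mem_range.2 (hD i)]
    refine prod_congr rfl fun d' _ => ?_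
    have hj : ∀ j ∈ ({j | c j = d'} : Finset (Fin n)),
        (if P (c i) (c j) then g i j else 1) = if P d d' then g i j else 1 := by
      intro j hj
      rw [hi, (mem_filter_univ j).1 hj]
    rw [prod_congr rfl hj]
    split_ifs <;> simp
  rw [prod_congr rfl h, prod_comm]
  refine prod_congr rfl fun d' _ => ?_
  split_ifs <;> simp

theorem card_colorPairs {c : Fin n → ℕ} {D : ℕ} (hD : ∀ i, c i < D)
    (P : ℕ → ℕ → Prop) [DecidableRel P] :
    #(colorPairs c P) = ∑ d ∈ range D, ∑ d' ∈ range D,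
      if P d d' then #{i | c i = d} * #{i | c i = d'} else 0 := by
  rw [card_eq_sum_ones, sum_colorPairs hD P fun _ _ => 1]
  simp

/-- The colors of the roots of `𝔫 ∩ 𝔩`. -/
abbrev IsNL (a b : ℕ) : Prop := a = 0 ∧ b = 2 ∨ a = 1 ∧ b = 4

/-- The colors of the roots of `𝔭₁`. -/
abbrev IsP1 (a b : ℕ) : Prop := a = 0 ∧ b = 3 ∨ a = 3 ∧ b = 1

/-- The colors of the positive roots of `𝔨` outside `𝔩`. -/
abbrev IsKNotL (a b : ℕ) : Prop := a < b ∧ (b ≤ 1 ∨ 2 ≤ a)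

/-- The coarsening of a five-coloring with classes `{0, 1}` and `{2, 3, 4}`. -/
def coarse (c : Fin n → ℕ) (i : Fin n) : ℕ := if c i ≤ 1 then 0 else 1

theorem disjoint_samePairs_colorPairs (c : Fin n → ℕ) :
    Disjoint (samePairs c) (colorPairs c IsKNotL) := by
  rw [disjoint_left]
  intro e
  simp only [samePairs, colorPairs, mem_filter_univ]
  omega

theorem samePairs_coarse {c : Fin n → ℕ} (hc : Monotone c) :
    samePairs (coarse c) = samePairs c ∪ colorPairs c IsKNotL := by
  ext ⟨i, j⟩
  simp only [samePairs, colorPairs, mem_filter_univ, mem_union]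
  simp only [coarse]
  have h1 : i ≤ j → c i ≤ c j := fun h => hc h
  have h2 : j ≤ i → c j ≤ c i := fun h => hc h
  rcases lt_or_ge i j with h | h
  · have := h1 h.le
    simp only [h, true_and, IsKNotL]
    grind
  · have := h2 h
    simp only [h.not_gt, false_and, false_or, IsKNotL]
    exact iff_of_false id (by omega)

theorem vand_coarse {c : Fin n → ℕ} (hc : Monotone c) (y : Fin n → ℚ) :
    vand (coarse c) y = vand c y * ∏ e ∈ colorPairs c IsKNotL, (y e.1 - y e.2) := by
  rw [vand, samePairs_coarse hc, prod_union (disjoint_samePairs_colorPairs c)]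
  rfl

theorem prod_prod_sub_swap (A B : Finset (Fin n)) (y : Fin n → ℚ) :
    ∏ i ∈ A, ∏ j ∈ B, (y i - y j) = (-1) ^ (#A * #B) * ∏ j ∈ B, ∏ i ∈ A, (y j - y i) := by
  rw [prod_comm (s := B), mul_comm (#A), pow_mul, ← prod_const, ← prod_mul_distrib]
  refine prod_congr rfl fun i _ => ?_
  rw [← prod_const, ← prod_mul_distrib]
  exact prod_congr rfl fun j _ => by ring

/-- If `y` takes the same values on the classes `0` and `4`, and on the classes `1` and `2`, then
the products of the differences over the roots of `𝔫 ∩ 𝔩` and `𝔭₁` and over the positive roots of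
`𝔨` outside `𝔩` agree up to sign. -/
theorem prod_colorPairs_mul_prod_colorPairs {c : Fin n → ℕ} (hD : ∀ i, c i < 5) {y : Fin n → ℚ}
    (h04 : ∀ f : ℚ → ℚ, ∏ i with c i = 0, f (y i) = ∏ i with c i = 4, f (y i))
    (h12 : ∀ f : ℚ → ℚ, ∏ i with c i = 1, f (y i) = ∏ i with c i = 2, f (y i)) :
    (∏ e ∈ colorPairs c IsNL, (y e.1 - y e.2)) * ∏ e ∈ colorPairs c IsP1, (y e.1 - y e.2) =
      (-1) ^ (#{i | c i = 4} * #{i | c i = 3} + #{i | c i = 3} * #{i | c i = 2}) *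
        ∏ e ∈ colorPairs c IsKNotL, (y e.1 - y e.2) := by
  rw [prod_colorPairs hD IsNL fun i j => y i - y j, prod_colorPairs hD IsP1 fun i j => y i - y j,
    prod_colorPairs hD IsKNotL fun i j => y i - y j]
  simp only [prod_range_succ, prod_range_zero, IsNL, IsP1, IsKNotL]
  norm_num
  have e02 : ∏ i with c i = 0, ∏ j with c j = 2, (y i - y j) =
      ∏ i with c i = 0, ∏ j with c j = 1, (y i - y j) :=
    prod_congr rfl fun i _ => (h12 fun t => y i - t).symm
  have e14 : ∏ i with c i = 1, ∏ j with c j = 4, (y i - y j) =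
      ∏ i with c i = 2, ∏ j with c j = 4, (y i - y j) :=
    h12 fun t => ∏ j with c j = 4, (t - y j)
  have e03 : ∏ i with c i = 0, ∏ j with c j = 3, (y i - y j) =
      ∏ i with c i = 4, ∏ j with c j = 3, (y i - y j) :=
    h04 fun t => ∏ j with c j = 3, (t - y j)
  have e31 : ∏ i with c i = 3, ∏ j with c j = 1, (y i - y j) =
      ∏ i with c i = 3, ∏ j with c j = 2, (y i - y j) :=
    prod_congr rfl fun i _ => h12 fun t => y i - t
  rw [e02, e14, e03, e31, prod_prod_sub_swap (filter (fun i => c i = 4) univ),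
    prod_prod_sub_swap (filter (fun i => c i = 3) univ) (filter (fun i => c i = 2) univ), pow_add]
  ring

theorem card_colorPairs_add_card_colorPairs {c : Fin n → ℕ} (hD : ∀ i, c i < 5)
    (h04 : #{i | c i = 0} = #{i | c i = 4}) (h12 : #{i | c i = 1} = #{i | c i = 2}) :
    #(colorPairs c IsNL) + #(colorPairs c IsP1) = #(colorPairs c IsKNotL) := by
  rw [card_colorPairs hD, card_colorPairs hD, card_colorPairs hD]
  simp only [sum_range_succ, sum_range_zero, IsNL, IsP1, IsKNotL]
  norm_num
  rw [h04, h12]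
  ring

variable (k m r : ℕ)

/-- The values of a point whose first `k + m` coordinates are `0, …, k + m - 1` and whose last
coordinates are `k, …, k + m - 1`, then `r` further values, then `0, …, k - 1`. -/
def pairedVal (i : Fin (k + m + (k + m + r))) : ℕ :=
  if (i : ℕ) < k + m then i
  else if (i : ℕ) < k + m + m then i - m
  else if (i : ℕ) < k + m + m + r then i
  else i - (k + m + m + r)

/-- The coloring in which the indices with value in `S` have color `0` or `4`, the indices with
other values below `k + m` have color `1` or `2`, and the remaining indices have color `3`. -/
def valColor (S : Finset ℕ) (i : Fin (k + m + (k + m + r))) : ℕ :=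
  if (i : ℕ) < k + m then if pairedVal k m r i ∈ S then 0 else 1
  else if pairedVal k m r i ∈ S then 4
  else if pairedVal k m r i < k + m then 2 else 3

/-- The coloring by the five index blocks. -/
def blockColor (i : Fin (k + m + (k + m + r))) : ℕ :=
  if (i : ℕ) < k then 0
  else if (i : ℕ) < k + m then 1
  else if (i : ℕ) < k + m + m then 2
  else if (i : ℕ) < k + m + m + r then 3 else 4

theorem valColor_range : valColor k m r (range k) = blockColor k m r := by
  funext i
  simp only [valColor, blockColor, pairedVal, mem_range]
  have := i.2
  split_ifs <;> omega

theorem monotone_blockColor : Monotone (blockColor k m r) := by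
  intro i j h
  have h : (i : ℕ) ≤ j := h
  simp only [blockColor]
  split_ifs <;> omega

variable {k m r}

theorem valColor_lt (S : Finset ℕ) (i : Fin (k + m + (k + m + r))) : valColor k m r S i < 5 := by
  simp only [valColor]
  split_ifs <;> omega

theorem coarse_valColor (S : Finset ℕ) (i : Fin (k + m + (k + m + r))) :
    coarse (valColor k m r S) i = if (i : ℕ) < k + m then 0 else 1 := by
  simp only [coarse, valColor]
  split_ifs <;> omega

theorem coarse_blockColor (i : Fin (k + m + (k + m + r))) :
    coarse (blockColor k m r) i = if (i : ℕ) < k + m then 0 else 1 := by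
  rw [← valColor_range, coarse_valColor]

theorem pairedVal_injective {i j : Fin (k + m + (k + m + r))}
    (h : (i : ℕ) < k + m ↔ (j : ℕ) < k + m) (hv : pairedVal k m r i = pairedVal k m r j) :
    i = j := by
  have := i.2
  have := j.2
  simp only [pairedVal] at hv
  ext
  split_ifs at hv <;> omega

@[to_additive]
theorem prod_lower_pairedVal {M : Type*} [CommMonoid M] {T : Finset ℕ} (hT : T ⊆ range (k + m))
    (f : ℕ → M) :
    ∏ i ∈ univ.filter fun i : Fin (k + m + (k + m + r)) =>
        (i : ℕ) < k + m ∧ pairedVal k m r i ∈ T, f (pairedVal k m r i) = ∏ t ∈ T, f t := by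
  refine prod_bij (fun i _ => pairedVal k m r i) ?_ ?_ ?_ ?_
  · simp
  · intro i hi j hj h
    rw [mem_filter_univ] at hi hj
    exact pairedVal_injective (iff_of_true hi.1 hj.1) h
  · intro t ht
    have h := mem_range.1 (hT ht)
    have hv : pairedVal k m r ⟨t, by omega⟩ = t := by simp [pairedVal, h]
    exact ⟨⟨t, by omega⟩, by simp [hv, ht, h], hv⟩
  · simp

@[to_additive]
theorem prod_upper_pairedVal {M : Type*} [CommMonoid M] {T : Finset ℕ} (hT : T ⊆ range (k + m))
    (f : ℕ → M) :
    ∏ i ∈ univ.filter fun i : Fin (k + m + (k + m + r)) =>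
        ¬ (i : ℕ) < k + m ∧ pairedVal k m r i ∈ T, f (pairedVal k m r i) = ∏ t ∈ T, f t := by
  refine prod_bij (fun i _ => pairedVal k m r i) ?_ ?_ ?_ ?_
  · simp
  · intro i hi j hj h
    rw [mem_filter_univ] at hi hj
    exact pairedVal_injective (iff_of_false hi.1 hj.1) h
  · intro t ht
    have h := mem_range.1 (hT ht)
    obtain ⟨j, hj, hv⟩ : ∃ j : Fin (k + m + (k + m + r)), ¬ (j : ℕ) < k + m ∧
        pairedVal k m r j = t := by
      refine ⟨⟨if t < k then t + (k + m + m + r) else t + m, by split_ifs <;> omega⟩, ?_, ?_⟩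
      · dsimp only
        split_ifs <;> omega
      · simp only [pairedVal]
        split_ifs <;> omega
    exact ⟨j, (mem_filter_univ j).2 ⟨hj, hv.symm ▸ ht⟩, hv⟩
  · simp

theorem filter_valColor_zero {S : Finset ℕ} :
    univ.filter (fun i => valColor k m r S i = 0) =
      univ.filter fun i : Fin (k + m + (k + m + r)) => (i : ℕ) < k + m ∧ pairedVal k m r i ∈ S := by
  ext i
  simp only [mem_filter_univ]
  simp only [valColor]
  split_ifs <;> simp [*]

theorem filter_valColor_four {S : Finset ℕ} :
    univ.filter (fun i => valColor k m r S i = 4) =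
      univ.filter fun i : Fin (k + m + (k + m + r)) =>
        ¬ (i : ℕ) < k + m ∧ pairedVal k m r i ∈ S := by
  ext i
  simp only [mem_filter_univ]
  simp only [valColor]
  split_ifs <;> simp [*]

theorem filter_valColor_one {S : Finset ℕ} :
    univ.filter (fun i => valColor k m r S i = 1) =
      univ.filter fun i : Fin (k + m + (k + m + r)) =>
        (i : ℕ) < k + m ∧ pairedVal k m r i ∈ range (k + m) \ S := by
  ext i
  have : (i : ℕ) < k + m → pairedVal k m r i < k + m := by
    intro h
    simp [pairedVal, h]
  simp only [mem_filter_univ, mem_sdiff, mem_range]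
  simp only [valColor]
  split_ifs <;> simp [*]

theorem filter_valColor_two {S : Finset ℕ} :
    univ.filter (fun i => valColor k m r S i = 2) =
      univ.filter fun i : Fin (k + m + (k + m + r)) =>
        ¬ (i : ℕ) < k + m ∧ pairedVal k m r i ∈ range (k + m) \ S := by
  ext i
  simp only [mem_filter_univ, mem_sdiff, mem_range]
  simp only [valColor]
  split_ifs <;> simp [*]

theorem valColor_eq_three_iff {S : Finset ℕ} (hS : S ⊆ range (k + m))
    (i : Fin (k + m + (k + m + r))) :
    valColor k m r S i = 3 ↔ k + m + m ≤ (i : ℕ) ∧ (i : ℕ) < k + m + m + r := by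
  have h1 : pairedVal k m r i ∈ S → pairedVal k m r i < k + m := fun h => mem_range.1 (hS h)
  have := i.2
  have h2 : pairedVal k m r i < k + m ↔
      ¬ (k + m + m ≤ (i : ℕ) ∧ (i : ℕ) < k + m + m + r) := by
    simp only [pairedVal]
    split_ifs <;> omega
  simp only [valColor]
  split_ifs with h3 h4 h4 h5
  · exact iff_of_false (by simp) (by omega)
  · exact iff_of_false (by simp) (by omega)
  · exact iff_of_false (by simp) (h2.1 (h1 h4))
  · exact iff_of_false (by simp) (h2.1 h5)
  · exact iff_of_true rfl (not_not.1 (mt h2.2 h5))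

theorem card_filter_blockColor_two : #{i | blockColor k m r i = 2} = m := by
  rw [← valColor_range, filter_valColor_two, card_eq_sum_ones,
    sum_upper_pairedVal sdiff_subset fun _ => 1, ← card_eq_sum_ones,
    card_sdiff_of_subset (range_subset_range.2 (k.le_add_right m))]
  simp

theorem card_filter_blockColor_four : #{i | blockColor k m r i = 4} = k := by
  rw [← valColor_range, filter_valColor_four, card_eq_sum_ones,
    sum_upper_pairedVal (range_subset_range.2 (k.le_add_right m)) fun _ => 1, ← card_eq_sum_ones,
    card_range]

theorem card_filter_blockColor_three : #{i | blockColor k m r i = 3} = r := by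
  have h : #{i | blockColor k m r i = 3} = #(Ico (k + m + m) (k + m + m + r)) := by
    rw [← valColor_range]
    simp only [valColor_eq_three_iff (range_subset_range.2 (k.le_add_right m))]
    refine card_bij (fun i _ => (i : ℕ)) (by simp) (fun i _ j _ h => Fin.ext h) fun t ht => ?_
    rw [mem_Ico] at ht
    exact ⟨⟨t, by omega⟩, by simpa using ht, rfl⟩
  simpa using h

theorem card_filter_valColor {S : Finset ℕ} (hS : S ∈ powersetCard k (range (k + m))) (d : ℕ) :
    #{i | valColor k m r S i = d} = #{i | blockColor k m r i = d} := by
  obtain ⟨hS, hSk⟩ := mem_powersetCard.1 hS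
  have hR := range_subset_range.2 (k.le_add_right m)
  rw [← valColor_range]
  rcases lt_or_ge d 5 with hd | hd
  · interval_cases d
    · rw [filter_valColor_zero, filter_valColor_zero, card_eq_sum_ones, card_eq_sum_ones,
        sum_lower_pairedVal hS fun _ => 1, sum_lower_pairedVal hR fun _ => 1]
      simp [hSk]
    · rw [filter_valColor_one, filter_valColor_one, card_eq_sum_ones, card_eq_sum_ones,
        sum_lower_pairedVal sdiff_subset fun _ => 1, sum_lower_pairedVal sdiff_subset fun _ => 1,
        ← card_eq_sum_ones, ← card_eq_sum_ones, card_sdiff_of_subset hS, card_sdiff_of_subset hR]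
      simp [hSk]
    · rw [filter_valColor_two, filter_valColor_two, card_eq_sum_ones, card_eq_sum_ones,
        sum_upper_pairedVal sdiff_subset fun _ => 1, sum_upper_pairedVal sdiff_subset fun _ => 1,
        ← card_eq_sum_ones, ← card_eq_sum_ones, card_sdiff_of_subset hS, card_sdiff_of_subset hR]
      simp [hSk]
    · simp only [valColor_eq_three_iff hS, valColor_eq_three_iff hR]
    · rw [filter_valColor_four, filter_valColor_four, card_eq_sum_ones, card_eq_sum_ones,
        sum_upper_pairedVal hS fun _ => 1, sum_upper_pairedVal hR fun _ => 1]
      simp [hSk]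
  · rw [filter_false_of_mem, filter_false_of_mem]
    · exact fun i _ => ((valColor_lt _ i).trans_le hd).ne
    · exact fun i _ => ((valColor_lt _ i).trans_le hd).ne

/-- The permutations carrying the block coloring to the coloring `valColor k m r S`. -/
def matchPerms (k m r : ℕ) (S : Finset ℕ) : Finset (Equiv.Perm (Fin (k + m + (k + m + r)))) :=
  univ.filter fun w => ∀ i, valColor k m r S (w i) = blockColor k m r i

theorem card_matchPerms {S : Finset ℕ} (hS : S ∈ powersetCard k (range (k + m))) :
    #(matchPerms k m r S) = #(colorPerms (blockColor k m r)) := by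
  have e : ∀ d, {i // blockColor k m r i = d} ≃ {i // valColor k m r S i = d} := fun d =>
    Fintype.equivOfCardEq (by
      rw [Fintype.card_subtype, Fintype.card_subtype, card_filter_valColor hS])
  set w₀ : Equiv.Perm (Fin (k + m + (k + m + r))) := Equiv.ofFiberEquiv e
  have hw₀ : ∀ i, valColor k m r S (w₀ i) = blockColor k m r i := Equiv.ofFiberEquiv_map e
  refine card_nbij' (w₀⁻¹ * ·) (w₀ * ·) ?_ ?_
    (fun w _ => mul_inv_cancel_left w₀ w) (fun w _ => inv_mul_cancel_left w₀ w)
  · intro w hw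
    simp only [matchPerms, coe_filter, mem_univ, true_and, Set.mem_ofPred_eq] at hw
    rw [mem_coe, mem_colorPerms]
    intro i
    rw [← hw₀, ← hw i]
    simp
  · intro w hw
    rw [mem_coe, mem_colorPerms] at hw
    simp [matchPerms, hw₀, hw]

theorem matchPerms_subset (S : Finset ℕ) :
    matchPerms k m r S ⊆ colorPerms (coarse (blockColor k m r)) := by
  intro w hw
  rw [matchPerms, mem_filter_univ] at hw
  rw [mem_colorPerms]
  intro i
  rw [coarse_blockColor, ← coarse_valColor S, coarse, coarse, hw]

theorem eq_of_mem_matchPerms {S T : Finset ℕ} (hS : S ⊆ range (k + m)) (hT : T ⊆ range (k + m))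
    {w : Equiv.Perm (Fin (k + m + (k + m + r)))} (hwS : w ∈ matchPerms k m r S)
    (hwT : w ∈ matchPerms k m r T) : S = T := by
  have key : ∀ {U : Finset ℕ}, U ⊆ range (k + m) → w ∈ matchPerms k m r U →
      U = ({i | blockColor k m r i = 0} : Finset (Fin (k + m + (k + m + r)))).image
        fun i => pairedVal k m r (w i) := by
    intro U hU hw
    rw [matchPerms, mem_filter_univ] at hw
    simp only [← hw]
    ext t
    simp only [mem_image, mem_filter_univ]
    constructor
    · intro ht
      have h := mem_range.1 (hU ht)
      have hv : pairedVal k m r ⟨t, by omega⟩ = t := by simp [pairedVal, h]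
      refine ⟨w⁻¹ ⟨t, by omega⟩, ?_, by simpa using hv⟩
      simp [valColor, hv, ht, h]
    · rintro ⟨i, hi, rfl⟩
      simp only [valColor] at hi
      split_ifs at hi with h1 h2
      exact h2
  rw [key hS hwS, ← key hT hwT]

theorem prod_filter_of_mem_matchPerms {M : Type*} [CommMonoid M] {S : Finset ℕ}
    {w : Equiv.Perm (Fin (k + m + (k + m + r)))} (hw : w ∈ matchPerms k m r S) (d : ℕ)
    (f : ℕ → M) :
    ∏ i with blockColor k m r i = d, f (pairedVal k m r (w i)) =
      ∏ i with valColor k m r S i = d, f (pairedVal k m r i) := by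
  rw [matchPerms, mem_filter_univ] at hw
  exact prod_equiv w (by simp [hw]) (by simp)

/-- The product of the linear forms of the roots of `𝔫 ∩ 𝔩` and of `𝔭₁`. -/
noncomputable def rootPoly (c : Fin n → ℕ) : MvPolynomial (Fin n) ℚ :=
  (∏ e ∈ colorPairs c IsNL, (X e.1 - X e.2)) * ∏ e ∈ colorPairs c IsP1, (X e.1 - X e.2)

theorem eval_rootPoly (c : Fin n → ℕ) (y : Fin n → ℚ) :
    eval y (rootPoly c) = (∏ e ∈ colorPairs c IsNL, (y e.1 - y e.2)) *
      ∏ e ∈ colorPairs c IsP1, (y e.1 - y e.2) := by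
  simp [rootPoly]

theorem eval_rootPoly_of_mem_matchPerms {S : Finset ℕ} (hS : S ⊆ range (k + m))
    {w : Equiv.Perm (Fin (k + m + (k + m + r)))} (hw : w ∈ matchPerms k m r S) :
    eval ((fun i => (pairedVal k m r i : ℚ)) ∘ w)
        (rootPoly (blockColor k m r) * vand (blockColor k m r) X) =
      (-1) ^ (k * r + r * m) *
        vand (coarse (blockColor k m r)) ((fun i => (pairedVal k m r i : ℚ)) ∘ w) := by
  have hD : ∀ i, blockColor k m r i < 5 := by
    rw [← valColor_range]
    exact valColor_lt _
  rw [map_mul, eval_vand, eval_rootPoly, vand_coarse (monotone_blockColor k m r),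
    prod_colorPairs_mul_prod_colorPairs hD, card_filter_blockColor_two,
    card_filter_blockColor_three, card_filter_blockColor_four]
  · ring
  · intro f
    have h := fun d => prod_filter_of_mem_matchPerms hw d fun t => f t
    simp only [Function.comp_apply]
    rw [h, h, filter_valColor_zero, filter_valColor_four, prod_lower_pairedVal hS fun t => f t,
      prod_upper_pairedVal hS fun t => f t]
  · intro f
    have h := fun d => prod_filter_of_mem_matchPerms hw d fun t => f t
    simp only [Function.comp_apply]
    rw [h, h, filter_valColor_one, filter_valColor_two,
      prod_lower_pairedVal sdiff_subset fun t => f t,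
      prod_upper_pairedVal sdiff_subset fun t => f t]

theorem vand_coarse_pairedVal_ne_zero :
    vand (coarse (blockColor k m r)) (fun i => (pairedVal k m r i : ℚ)) ≠ 0 := by
  rw [vand, prod_ne_zero_iff]
  intro e he
  rw [samePairs, mem_filter_univ, coarse_blockColor, coarse_blockColor] at he
  intro h
  refine he.1.ne (pairedVal_injective ?_ (Nat.cast_injective (R := ℚ) (sub_eq_zero.1 h)))
  have := he.2
  split_ifs at this with h1 h2 h2
  · exact iff_of_true h1 h2
  · exact iff_of_false h1 h2

theorem exists_mem_matchPerms_of_eval_ne_zero {w : Equiv.Perm (Fin (k + m + (k + m + r)))}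
    (hw : w ∈ colorPerms (coarse (blockColor k m r)))
    (h : eval ((fun i => (pairedVal k m r i : ℚ)) ∘ w) (rootPoly (blockColor k m r)) ≠ 0) :
    ∃ S ∈ powersetCard k (range (k + m)), w ∈ matchPerms k m r S := by
  set c := blockColor k m r with hc
  set v := pairedVal k m r with hv
  have hlow : ∀ i, (w i : ℕ) < k + m ↔ (i : ℕ) < k + m := by
    intro i
    have := mem_colorPerms.1 hw i
    rw [coarse_blockColor, coarse_blockColor] at this
    split_ifs at this <;> simp [*]
  have hvlow : ∀ i : Fin (k + m + (k + m + r)), (i : ℕ) < k + m → v i = i := by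
    intro i hi
    simp [hv, pairedVal, hi]
  have hc3 : ∀ i, c i = 3 ↔ ¬ (i : ℕ) < k + m ∧ ¬ v i < k + m := by
    intro i
    have := i.2
    simp only [hc, hv, blockColor, pairedVal]
    split_ifs <;> simp <;> omega
  have hcl : ∀ i : Fin (k + m + (k + m + r)), (i : ℕ) < k + m ↔ c i = 0 ∨ c i = 1 := by
    intro i
    simp only [hc, blockColor]
    split_ifs <;> simp <;> omega
  rw [eval_rootPoly, mul_ne_zero_iff, prod_ne_zero_iff, prod_ne_zero_iff] at h
  have hNL : ∀ i j, IsNL (c i) (c j) → v (w i) ≠ v (w j) := by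
    intro i j hij he
    exact h.1 (i, j) (by simpa [colorPairs] using hij) (by simp [he])
  have hP1 : ∀ i j, IsP1 (c i) (c j) → v (w i) ≠ v (w j) := by
    intro i j hij he
    exact h.2 (i, j) (by simpa [colorPairs] using hij) (by simp [he])
  have hpartner : ∀ i, v (w i) < k + m → ∃ j, (c j = 0 ∨ c j = 1) ∧ v (w j) = v (w i) := by
    intro i hi
    refine ⟨w⁻¹ ⟨v (w i), by omega⟩, ?_, ?_⟩
    · rw [← hcl, ← hlow]
      simpa using hi
    · rw [hvlow]
      · simp
      · simpa using hi
  have hw3 : ∀ i, c i = 3 → c (w i) = 3 := by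
    intro i hi
    refine (hc3 _).2 ⟨(hlow i).not.2 ((hc3 i).1 hi).1, fun hlt => ?_⟩
    obtain ⟨j, hj | hj, hji⟩ := hpartner i hlt
    · exact hP1 j i (.inl ⟨hj, hi⟩) hji
    · exact hP1 i j (.inr ⟨hi, hj⟩) hji.symm
  have hw3' : ∀ i, c (w i) = 3 → c i = 3 := by
    intro i hi
    have himg : image w {i | c i = 3} = univ.filter fun i => c i = 3 := by
      refine eq_of_subset_of_card_le ?_ (card_image_of_injective _ w.injective).ge
      intro j hj
      obtain ⟨t, ht, rfl⟩ := mem_image.1 hj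
      simpa using hw3 t (by simpa using ht)
    have hmem : w i ∈ image w {i | c i = 3} := by
      rw [himg]
      simpa using hi
    obtain ⟨t, ht, hti⟩ := mem_image.1 hmem
    rw [← w.injective hti]
    simpa using ht
  set S : Finset ℕ := image (fun i => v (w i)) {i | c i = 0} with hS
  have hSlow : ∀ i, (c i = 0 ∨ c i = 1) → (v (w i) ∈ S ↔ c i = 0) := by
    intro i hi
    simp only [hS, mem_image, mem_filter_univ]
    constructor
    · rintro ⟨j, hj, hji⟩
      have : w j = w i := pairedVal_injective
        (iff_of_true ((hlow j).2 ((hcl j).2 (.inl hj))) ((hlow i).2 ((hcl i).2 hi))) hji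
      rwa [← w.injective this]
    · exact fun hi => ⟨i, hi, rfl⟩
  have hSsub : S ⊆ range (k + m) := by
    intro t ht
    simp only [hS, mem_image, mem_filter_univ] at ht
    obtain ⟨i, hi, rfl⟩ := ht
    have := (hlow i).2 ((hcl i).2 (.inl hi))
    rwa [hvlow _ this, mem_range]
  refine ⟨S, mem_powersetCard.2 ⟨hSsub, ?_⟩, ?_⟩
  · rw [hS, card_image_of_injOn, hc, ← valColor_range, filter_valColor_zero, card_eq_sum_ones,
      sum_lower_pairedVal (range_subset_range.2 (k.le_add_right m)) fun _ => 1]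
    · simp
    · intro i hi j hj hij
      simp only [coe_filter, mem_univ, true_and, Set.mem_ofPred_eq] at hi hj
      exact w.injective (pairedVal_injective
        (iff_of_true ((hlow i).2 ((hcl i).2 (.inl hi))) ((hlow j).2 ((hcl j).2 (.inl hj)))) hij)
  · rw [matchPerms, mem_filter_univ]
    intro i
    rw [← hc]
    have hlt : c i < 5 := by
      rw [hc, ← valColor_range]
      exact valColor_lt _ i
    simp only [valColor, ← hv]
    by_cases hi : (i : ℕ) < k + m
    · have hi' := (hcl i).1 hi
      rw [if_pos ((hlow i).2 hi)]
      rcases hi' with h0 | h1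
      · rw [if_pos ((hSlow i (.inl h0)).2 h0), h0]
      · rw [if_neg (fun hmem => by simpa [h1] using (hSlow i (.inr h1)).1 hmem), h1]
    · have hi' := (hcl i).not.1 hi
      rw [if_neg ((hlow i).not.2 hi)]
      by_cases hlt' : v (w i) < k + m
      · have h3 : c i ≠ 3 := fun h3 => ((hc3 _).1 (hw3 i h3)).2 hlt'
        obtain ⟨j, hj, hji⟩ := hpartner i hlt'
        rw [if_pos hlt', ← hji]
        rcases hj with h0 | h1
        · rw [if_pos ((hSlow j (.inl h0)).2 h0)]
          have : c i ≠ 2 := fun h2 => hNL j i (.inl ⟨h0, h2⟩) hji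
          omega
        · rw [if_neg (fun hmem => by simpa [h1] using (hSlow j (.inr h1)).1 hmem)]
          have : c i ≠ 4 := fun h4 => hNL j i (.inr ⟨h1, h4⟩) hji
          omega
      · rw [if_neg fun hmem => hlt' (mem_range.1 (hSsub hmem)), if_neg hlt']
        exact (hw3' i ((hc3 _).2 ⟨(hlow i).not.2 hi, hlt'⟩)).symm

theorem sum_sign_eval_rootPoly :
    ∑ w ∈ colorPerms (coarse (blockColor k m r)), ((w.sign : ℤ) : ℚ) *
        eval ((fun i => (pairedVal k m r i : ℚ)) ∘ w)
          (rootPoly (blockColor k m r) * vand (blockColor k m r) X) =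
      #(colorPerms (blockColor k m r)) * ((-1) ^ (k * r + r * m) * ((k + m).choose k)) *
        vand (coarse (blockColor k m r)) (fun i => (pairedVal k m r i : ℚ)) := by
  set x : Fin (k + m + (k + m + r)) → ℚ := fun i => pairedVal k m r i
  set V := vand (coarse (blockColor k m r)) x
  have hterm : ∀ w ∈ colorPerms (coarse (blockColor k m r)), ((w.sign : ℤ) : ℚ) *
      eval (x ∘ w) (rootPoly (blockColor k m r) * vand (blockColor k m r) X) =
      ∑ S ∈ powersetCard k (range (k + m)),
        if w ∈ matchPerms k m r S then (-1) ^ (k * r + r * m) * V else 0 := by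
    intro w hw
    by_cases h : ∃ S ∈ powersetCard k (range (k + m)), w ∈ matchPerms k m r S
    · obtain ⟨S, hS, hwS⟩ := h
      have hS' := (mem_powersetCard.1 hS).1
      rw [sum_eq_single_of_mem S hS fun T hT hne => if_neg fun hwT => hne
          (eq_of_mem_matchPerms (mem_powersetCard.1 hT).1 hS' hwT hwS), if_pos hwS,
        eval_rootPoly_of_mem_matchPerms hS' hwS, vand_comp hw, mul_left_comm,
        ← mul_assoc ((w.sign : ℤ) : ℚ) ((w.sign : ℤ) : ℚ), ← Int.cast_mul, ← Units.val_mul,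
        Int.units_mul_self]
      simp [V, x]
    · have h0 : eval (x ∘ w) (rootPoly (blockColor k m r)) = 0 := by
        by_contra hne
        exact h (exists_mem_matchPerms_of_eval_ne_zero hw hne)
      rw [map_mul, h0, zero_mul, mul_zero, sum_eq_zero]
      exact fun S hS => if_neg fun hwS => h ⟨S, hS, hwS⟩
  rw [sum_congr rfl hterm, sum_comm]
  have hS : ∀ S ∈ powersetCard k (range (k + m)),
      (∑ w ∈ colorPerms (coarse (blockColor k m r)),
        if w ∈ matchPerms k m r S then (-1 : ℚ) ^ (k * r + r * m) * V else 0) =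
      #(colorPerms (blockColor k m r)) * ((-1) ^ (k * r + r * m) * V) := by
    intro S hS
    rw [← sum_filter, filter_mem_eq_inter, inter_eq_right.2 (matchPerms_subset S), sum_const,
      card_matchPerms hS, nsmul_eq_mul]
  rw [sum_congr rfl hS, sum_const, card_powersetCard, card_range, nsmul_eq_mul]
  ring

theorem isHomogeneous_rootPoly (c : Fin n → ℕ) :
    (rootPoly c).IsHomogeneous (#(colorPairs c IsNL) + #(colorPairs c IsP1)) :=
  (isHomogeneous_prod_sub _).mul (isHomogeneous_prod_sub _)

theorem card_rootPoly_add_sum_rho :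
    #(colorPairs (blockColor k m r) IsNL) + #(colorPairs (blockColor k m r) IsP1) +
      ∑ i, rho (blockColor k m r) i = ∑ i, rho (coarse (blockColor k m r)) i := by
  have hD : ∀ i, blockColor k m r i < 5 := by
    rw [← valColor_range]
    exact valColor_lt _
  rw [sum_rho, sum_rho, samePairs_coarse (monotone_blockColor k m r),
    card_union_of_disjoint (disjoint_samePairs_colorPairs _),
    card_colorPairs_add_card_colorPairs hD, add_comm]
  · rw [card_filter_blockColor_four, ← valColor_range, filter_valColor_zero, card_eq_sum_ones,
      sum_lower_pairedVal (range_subset_range.2 (k.le_add_right m)) fun _ => 1]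
    simp
  · rw [← valColor_range, filter_valColor_one, filter_valColor_two, card_eq_sum_ones,
      card_eq_sum_ones, sum_lower_pairedVal sdiff_subset fun _ => 1,
      sum_upper_pairedVal sdiff_subset fun _ => 1]

theorem sum_sign_coeff_rootPoly :
    ∑ w ∈ colorPerms (coarse (blockColor k m r)), ((w.sign : ℤ) : ℚ) *
        coeff (toExp (rho (coarse (blockColor k m r)) ∘ w))
          (rootPoly (blockColor k m r) * vand (blockColor k m r) X) =
      #(colorPerms (blockColor k m r)) * ((-1) ^ (k * r + r * m) * ((k + m).choose k)) := by
  refine mul_right_cancel₀ (vand_coarse_pairedVal_ne_zero (k := k) (m := m) (r := r)) ?_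
  rw [← sum_sign_eval_rootPoly, sum_sign_eval_comp]
  rw [← card_rootPoly_add_sum_rho]
  exact (totalDegree_mul _ _).trans
    (add_le_add (isHomogeneous_rootPoly _).totalDegree_le (totalDegree_vand_le _))

theorem colorPerms_subset_colorPerms_coarse (c : Fin n → ℕ) :
    colorPerms c ⊆ colorPerms (coarse c) := by
  intro w hw
  rw [mem_colorPerms] at *
  intro i
  rw [coarse, coarse, hw]

theorem sum_sign_coeff_rootPoly_mul_binSeries (x : Fin (k + m + (k + m + r)) → ℚ) :
    ∑ w ∈ colorPerms (coarse (blockColor k m r)), ((w.sign : ℤ) : ℚ) *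
        MvPowerSeries.coeff (toExp (rho (coarse (blockColor k m r)) ∘ w))
          ((rootPoly (blockColor k m r) : MvPowerSeries _ ℚ) * binSeries x) =
      (-1) ^ (k * r + r * m) * ((k + m).choose k) * weyl (blockColor k m r) x := by
  have hcard : (#(colorPerms (blockColor k m r)) : ℚ) ≠ 0 :=
    Nat.cast_ne_zero.2 (card_ne_zero_of_mem (one_mem_colorPerms _))
  refine mul_left_cancel₀ hcard ?_
  rw [card_mul_sum_coeff_binSeries (colorPerms_subset_colorPerms_coarse _)
    (isHomogeneous_rootPoly _) _ card_rootPoly_add_sum_rho, sum_sign_coeff_rootPoly]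
  · ring
  · intro v hv
    rw [rootPoly, map_mul, rename_prod_colorPairs hv, rename_prod_colorPairs hv]

theorem weyl_sub_leadCount (x : Fin (k + m + (k + m + r)) → ℚ) :
    weyl (blockColor k m r) (fun i => x i - leadCount (colorPairs (blockColor k m r) IsNL) i -
      leadCount (colorPairs (blockColor k m r) IsP1) i) = weyl (blockColor k m r) x := by
  rw [weyl_eq_prod (monotone_blockColor k m r), weyl_eq_prod (monotone_blockColor k m r)]
  refine prod_congr rfl fun e he => ?_
  rw [samePairs, mem_filter_univ] at he
  rw [leadCount_colorPairs_congr IsNL he.2, leadCount_colorPairs_congr IsP1 he.2]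
  congr 1
  ring

theorem PK_eq_weyl (lam : ℕ → ℚ) :
    PK (k + m) (k + m + r) lam =
      weyl (coarse (blockColor k m r)) fun i => lam ((i : ℕ) + 1) := by
  rw [weyl_eq_prod_blockProd (D := 2) (B := fun d =>
    if d = 0 then Icc 1 (k + m) else Icc (k + m + 1) (k + m + (k + m + r)))]
  · simp [prod_range_succ, PK]
  · intro i j h
    have h : (i : ℕ) ≤ j := h
    rw [coarse_blockColor, coarse_blockColor]
    split_ifs <;> omega
  · intro i
    rw [coarse_blockColor]
    split_ifs <;> omega
  · intro d hd t
    simp only [coarse_blockColor]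
    constructor
    · intro h
      refine ⟨⟨t - 1, ?_⟩, ?_, ?_⟩
      all_goals
        interval_cases d <;> simp at h ⊢ <;> grind
    · rintro ⟨i, rfl, hi⟩
      have := i.2
      interval_cases d <;> split_ifs at hi <;> simp <;> omega

theorem PKL_eq_weyl (lam : ℕ → ℚ) :
    PKL (k + m) (k + m + r) k lam =
      weyl (blockColor k m r) fun i => lam ((i : ℕ) + 1) := by
  have h1 : 2 * (k + m) - k = k + m + m := by omega
  have h2 : k + m + (k + m + r) - k = k + m + m + r := by omega
  rw [weyl_eq_prod_blockProd (monotone_blockColor k m r) (D := 5) (B := fun d =>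
    if d = 0 then Icc 1 k else if d = 1 then Icc (k + 1) (k + m)
    else if d = 2 then Icc (k + m + 1) (k + m + m)
    else if d = 3 then Icc (k + m + m + 1) (k + m + m + r)
    else Icc (k + m + m + r + 1) (k + m + (k + m + r)))]
  · simp [prod_range_succ, PKL, h1, h2]
  · rw [← valColor_range]
    exact valColor_lt _
  · intro d hd t
    simp only [blockColor]
    constructor
    · intro h
      refine ⟨⟨t - 1, ?_⟩, ?_, ?_⟩
      all_goals
        interval_cases d <;> simp at h ⊢ <;> grind
    · rintro ⟨i, rfl, hi⟩
      have := i.2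
      interval_cases d <;> split_ifs at hi <;> simp <;> omega

theorem mem_map_succPair {T : Finset (Fin n × Fin n)} {e : ℕ × ℕ} :
    e ∈ T.map succPair ↔ ∃ i j : Fin n, (i, j) ∈ T ∧ (i : ℕ) + 1 = e.1 ∧ (j : ℕ) + 1 = e.2 := by
  simp [succPair_apply, Prod.ext_iff]

theorem DeltaNL_eq :
    DeltaNL (k + m) (k + m + r) k = (colorPairs (blockColor k m r) IsNL).map succPair := by
  ext ⟨a, b⟩
  rw [mem_map_succPair]
  simp only [DeltaNL, mem_union, mem_product, mem_Icc, colorPairs, mem_filter_univ]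
  simp only [blockColor]
  constructor
  · intro h
    refine ⟨⟨a - 1, by omega⟩, ⟨b - 1, by omega⟩, ?_, by dsimp only; omega, by dsimp only; omega⟩
    simp only [IsNL]
    split_ifs <;> omega
  · rintro ⟨i, j, h, rfl, rfl⟩
    have := i.2
    have := j.2
    split_ifs at h <;> omega

theorem DeltaP1_eq :
    DeltaP1 (k + m) (k + m + r) k = (colorPairs (blockColor k m r) IsP1).map succPair := by
  ext ⟨a, b⟩
  rw [mem_map_succPair]
  simp only [DeltaP1, mem_union, mem_product, mem_Icc, colorPairs, mem_filter_univ]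
  simp only [blockColor]
  constructor
  · intro h
    refine ⟨⟨a - 1, by omega⟩, ⟨b - 1, by omega⟩, ?_, by dsimp only; omega, by dsimp only; omega⟩
    simp only [IsP1]
    split_ifs <;> omega
  · rintro ⟨i, j, h, rfl, rfl⟩
    have := i.2
    have := j.2
    split_ifs at h <;> omega

theorem DSum_eq (lam : ℕ → ℚ) :
    DSum (k + m) (k + m + r) k lam =
      (-1) ^ (k * r + r * m) * ((k + m).choose k) * PKL (k + m) (k + m + r) k lam := by
  rw [DSum, DeltaNL_eq, DeltaP1_eq, PKL_eq_weyl]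
  simp only [PK_eq_weyl]
  rw [sum_sum_powerset_weyl _ _ _ fun i : Fin (k + m + (k + m + r)) => lam ((i : ℕ) + 1)]
  exact (sum_sign_coeff_rootPoly_mul_binSeries _).trans (by rw [weyl_sub_leadCount])

end FiveColors

/-- For `G_ℝ = SU(p,q)` (with `1 ≤ p ≤ q`, `0 ≤ k ≤ p`), for all `λ ∈ ℚ^n`:
`∑_{A ⊆ Δ_n^+(𝔩)} ∑_{C ⊆ Δ(𝔭_1)} (−1)^{|A|+|C|} P_K(λ − σ(A) − σ(C))
  = (−1)^{k(p−k)+k(q−p)+(p−k)(q−p+k)} · (p choose k) · P_{K∩L}(λ)`. -/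
theorem stmt_0 (p q k : ℕ) (hp : 1 ≤ p) (hpq : p ≤ q) (hk : k ≤ p) (lam : ℕ → ℚ) :
    DSum p q k lam =
      (-1 : ℚ) ^ (k * (p - k) + k * (q - p) + (p - k) * (q - p + k)) *
        (p.choose k) * PKL p q k lam := by
  obtain ⟨m, rfl⟩ := Nat.exists_eq_add_of_le hk
  obtain ⟨r, rfl⟩ := Nat.exists_eq_add_of_le hpq
  rw [DSum_eq, Nat.add_sub_cancel_left, Nat.add_sub_cancel_left]
  have h : k * m + k * r + m * (r + k) = k * r + r * m + 2 * (k * m) := by ring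
  rw [h, pow_add _ _ (2 * (k * m)), pow_mul, neg_one_sq, one_pow, mul_one]
end

section
/- There exists a rational number c such that for all λ ∈ ℚ^n, ∑_{A ⊆ Δ_n^+(𝔩)} ∑_{C ⊆ Δ(𝔭_1)} (−1)^{|A|+|C|} P_K(λ − σ(A) − σ(C)) = c · P_{K∩L}(λ). (This is the key polynomial identity underlying the main theorem, instantiated for G_ℝ = SU(p,q).) -/
open Finset

open MvPolynomial

section Translate

variable {σ R ι : Type*} [CommRing R]

/-- The translation operator `f(x) ↦ f(x - v)` on polynomials. -/
noncomputable def polyTranslate (v : σ → R) : MvPolynomial σ R →ₐ[R] MvPolynomial σ R :=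
  aeval fun i => X i - C (v i)

theorem eval_polyTranslate (v x : σ → R) (f : MvPolynomial σ R) :
    eval x (polyTranslate v f) = eval (fun i => x i - v i) f := by
  induction f using MvPolynomial.induction_on with
  | C a => simp [polyTranslate]
  | add p q hp hq => simp only [map_add, hp, hq]
  | mul_X p n hp =>
    rw [map_mul, map_mul, hp]
    simp [polyTranslate]

theorem polyTranslate_zero (f : MvPolynomial σ R) : polyTranslate (0 : σ → R) f = f := by
  simp [polyTranslate]

theorem polyTranslate_add (v w : σ → R) (f : MvPolynomial σ R) :
    polyTranslate (v + w) f = polyTranslate w (polyTranslate v f) := by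
  induction f using MvPolynomial.induction_on with
  | C a => simp [polyTranslate]
  | add p q hp hq => simp only [map_add, hp, hq]
  | mul_X p n hp =>
    simp only [map_mul, hp]
    simp [polyTranslate]
    ring

theorem totalDegree_polyTranslate_monomial [IsDomain R] (v : σ → R) (s : σ →₀ ℕ) (a : R) :
    (polyTranslate v (monomial s a)).totalDegree ≤ (monomial s a).totalDegree ∧
      (monomial s a - polyTranslate v (monomial s a)).totalDegree ≤
        (monomial s a).totalDegree - 1 := by
  refine MvPolynomial.induction_on_monomial
    (motive := fun f => (polyTranslate v f).totalDegree ≤ f.totalDegree ∧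
      (f - polyTranslate v f).totalDegree ≤ f.totalDegree - 1) ?_ ?_ s a
  · intro a
    simp [polyTranslate]
  · rintro f n ⟨h₁, h₂⟩
    by_cases hf : f = 0
    · simp [hf]
    have hX : polyTranslate v (X n : MvPolynomial σ R) = X n - C (v n) := by simp [polyTranslate]
    have hdeg : (f * X n).totalDegree = f.totalDegree + 1 := by
      rw [totalDegree_mul_of_isDomain hf (X_ne_zero n), totalDegree_X]
    rw [hdeg, map_mul, hX]
    refine ⟨(totalDegree_mul _ _).trans
      (add_le_add h₁ ((totalDegree_sub_C_le _ _).trans (totalDegree_X _).le)), ?_⟩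
    have key : f * X n - polyTranslate v f * (X n - C (v n)) =
        (f - polyTranslate v f) * X n + polyTranslate v f * C (v n) := by ring
    rw [key]
    refine (totalDegree_add _ _).trans (max_le ?_ ?_)
    · rcases Nat.eq_zero_or_pos f.totalDegree with h0 | h0
      · have : f - polyTranslate v f = 0 := by
          rw [totalDegree_eq_zero_iff_eq_C.mp h0]
          simp [polyTranslate]
        simp [this]
      · refine (totalDegree_mul _ _).trans ?_
        rw [totalDegree_X]
        omega
    · refine (totalDegree_mul _ _).trans ?_
      rw [totalDegree_C]
      omega

theorem totalDegree_sub_polyTranslate_le [IsDomain R] (v : σ → R) {f : MvPolynomial σ R} {d : ℕ}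
    (hf : f.totalDegree ≤ d + 1) : (f - polyTranslate v f).totalDegree ≤ d := by
  have h : f - polyTranslate v f = ∑ s ∈ f.support,
      (monomial s (coeff s f) - polyTranslate v (monomial s (coeff s f))) := by
    rw [sum_sub_distrib, ← map_sum, support_sum_monomial_coeff]
  rw [h]
  refine totalDegree_finsetSum_le fun s hs => ?_
  refine (totalDegree_polyTranslate_monomial v s (coeff s f)).2.trans ?_
  have h₁ := totalDegree_monomial s (mem_support_iff.mp hs)
  have h₂ := le_totalDegree hs
  omega

/-- The alternating sum over subsets `A ⊆ S` of the translates of `f` by `∑ i ∈ A, v i`. -/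
noncomputable def alternatingTranslate (v : ι → σ → R) (S : Finset ι) (f : MvPolynomial σ R) :
    MvPolynomial σ R :=
  ∑ A ∈ S.powerset, (-1) ^ A.card * polyTranslate (∑ i ∈ A, v i) f

theorem alternatingTranslate_insert [DecidableEq ι] (v : ι → σ → R) {S : Finset ι} {a : ι}
    (ha : a ∉ S) (f : MvPolynomial σ R) :
    alternatingTranslate v (insert a S) f =
      alternatingTranslate v S (f - polyTranslate (v a) f) := by
  simp only [alternatingTranslate, sum_powerset_insert ha, ← sum_add_distrib]
  refine sum_congr rfl fun A hA => ?_
  have haA : a ∉ A := fun h => ha (mem_powerset.mp hA h)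
  rw [card_insert_of_notMem haA, sum_insert haA, polyTranslate_add, map_sub, pow_succ]
  ring

theorem totalDegree_alternatingTranslate_le [IsDomain R] (v : ι → σ → R) (S : Finset ι)
    {f : MvPolynomial σ R} {d : ℕ} (hf : f.totalDegree ≤ d + S.card) :
    (alternatingTranslate v S f).totalDegree ≤ d := by
  classical
  induction S using Finset.induction_on generalizing f with
  | empty => simpa [alternatingTranslate, polyTranslate_zero] using hf
  | insert a S ha ih =>
    rw [alternatingTranslate_insert v ha]
    rw [card_insert_of_notMem ha, ← add_assoc] at hf
    exact ih (totalDegree_sub_polyTranslate_le _ hf)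

theorem eval_alternatingTranslate (v : ι → σ → R) (S : Finset ι) (f : MvPolynomial σ R)
    (x : σ → R) :
    eval x (alternatingTranslate v S f) =
      ∑ A ∈ S.powerset, (-1) ^ A.card * eval (fun t => x t - (∑ i ∈ A, v i) t) f := by
  simp [alternatingTranslate, eval_polyTranslate]

end Translate

section Pairs

variable {σ R : Type*} [CommRing R]

/-- The product of the linear forms `x_i - x_j` over the pairs `(i, j)` in `S`. -/
noncomputable def diffProd (R : Type*) [CommRing R] (S : Finset (σ × σ)) : MvPolynomial σ R :=
  ∏ x ∈ S, (X x.1 - X x.2)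

theorem eval_diffProd (S : Finset (σ × σ)) (x : σ → R) :
    eval x (diffProd R S) = ∏ y ∈ S, (x y.1 - x y.2) := by
  simp [diffProd]

theorem diffProd_isHomogeneous (S : Finset (σ × σ)) :
    (diffProd R S).IsHomogeneous S.card := by
  rw [card_eq_sum_ones]
  exact IsHomogeneous.prod _ _ _ fun x _ =>
    (isHomogeneous_X R x.1).sub (isHomogeneous_X R x.2)

variable [LinearOrder σ]

theorem diffProd_ne_zero [IsDomain R] {S : Finset (σ × σ)} (hS : ∀ x ∈ S, x.1 < x.2) :
    diffProd R S ≠ 0 :=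
  prod_ne_zero_iff.mpr fun x hx => sub_ne_zero.mpr fun h => (hS x hx).ne (X_injective h)

/-- The substitution `x_i ↦ x_j`. -/
noncomputable def identify (R : Type*) [CommRing R] (i j : σ) :
    MvPolynomial σ R →ₐ[R] MvPolynomial σ R :=
  aeval fun t => if t = i then X j else X t

theorem X_sub_X_dvd_sub_identify (i j : σ) (f : MvPolynomial σ R) :
    X i - X j ∣ f - identify R i j f := by
  induction f using MvPolynomial.induction_on with
  | C a => simp [identify]
  | add p q hp hq =>
    rw [map_add, add_sub_add_comm]
    exact dvd_add hp hq
  | mul_X p n hp =>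
    have hX : X i - X j ∣ X n - identify R i j (X n) := by
      by_cases h : n = i <;> simp [identify, h]
    rw [map_mul, show p * X n - identify R i j p * identify R i j (X n) =
      (p - identify R i j p) * X n + identify R i j p * (X n - identify R i j (X n)) by ring]
    exact dvd_add (hp.mul_right _) (hX.mul_left _)

theorem diffProd_dvd [IsDomain R] {S : Finset (σ × σ)} (hS : ∀ x ∈ S, x.1 < x.2)
    {f : MvPolynomial σ R} (hf : ∀ x ∈ S, identify R x.1 x.2 f = 0) : diffProd R S ∣ f := by
  induction S using Finset.induction_on with
  | empty => simp [diffProd]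
  | insert a S ha ih =>
    obtain ⟨g, rfl⟩ := ih (fun x hx => hS x (mem_insert_of_mem hx))
      fun x hx => hf x (mem_insert_of_mem hx)
    have h0 := hf a (mem_insert_self a S)
    rw [map_mul, mul_eq_zero] at h0
    have hne : identify R a.1 a.2 (diffProd R S) ≠ 0 := by
      rw [diffProd, map_prod]
      refine prod_ne_zero_iff.mpr fun x hx => ?_
      have hx' := hS x (mem_insert_of_mem hx)
      have ha' := hS a (mem_insert_self a S)
      have hxa : x ≠ a := fun h => ha (h ▸ hx)
      rw [map_sub, sub_ne_zero]
      simp only [identify, aeval_X, ← apply_ite (X (R := R))]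
      intro h
      have h := X_injective h
      obtain ⟨x₁, x₂⟩ := x
      obtain ⟨a₁, a₂⟩ := a
      simp only [ne_eq, Prod.mk.injEq] at *
      split_ifs at h <;> grind
    have hg := X_sub_X_dvd_sub_identify a.1 a.2 g
    rw [h0.resolve_left hne, sub_zero] at hg
    rw [diffProd, prod_insert ha, mul_comm]
    exact mul_dvd_mul_left _ hg

theorem exists_eq_C_mul_diffProd [IsDomain R] {S : Finset (σ × σ)} (hS : ∀ x ∈ S, x.1 < x.2)
    {f : MvPolynomial σ R} (hf : ∀ x ∈ S, identify R x.1 x.2 f = 0)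
    (hdeg : f.totalDegree ≤ S.card) : ∃ c : R, f = C c * diffProd R S := by
  obtain ⟨g, rfl⟩ := diffProd_dvd hS hf
  by_cases hg : g = 0
  · exact ⟨0, by simp [hg]⟩
  rw [totalDegree_mul_of_isDomain (diffProd_ne_zero hS) hg,
    (diffProd_isHomogeneous S).totalDegree (diffProd_ne_zero hS)] at hdeg
  refine ⟨g.coeff 0, ?_⟩
  rw [← totalDegree_eq_zero_iff_eq_C.mp (by omega : g.totalDegree = 0), mul_comm]

/-- The pairs `(i, j)` with `i < j` of elements of `B`. -/
def ltPairs (B : Finset σ) : Finset (σ × σ) := (B ×ˢ B).filter fun x => x.1 < x.2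

theorem mem_ltPairs {B : Finset σ} {x : σ × σ} :
    x ∈ ltPairs B ↔ (x.1 ∈ B ∧ x.2 ∈ B) ∧ x.1 < x.2 := by
  simp [ltPairs]

theorem two_mul_card_ltPairs (B : Finset σ) :
    2 * (ltPairs B).card + B.card = B.card * B.card := by
  induction B using Finset.induction_on_max with
  | empty => simp [ltPairs]
  | insert a B hB ih =>
    have ha : a ∉ B := fun h => (hB a h).false
    have h : ltPairs (insert a B) = ltPairs B ∪ B ×ˢ {a} := by
      ext ⟨x, y⟩
      simp only [mem_ltPairs, mem_union, mem_product, mem_insert, mem_singleton]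
      grind
    have hd : Disjoint (ltPairs B) (B ×ˢ {a}) := by
      rw [disjoint_left]
      rintro ⟨x, y⟩ h₁ h₂
      simp only [mem_ltPairs, mem_product, mem_singleton] at h₁ h₂
      exact ha (h₂.2 ▸ h₁.1.2)
    rw [h, card_union_of_disjoint hd, card_product, card_singleton, card_insert_of_notMem ha]
    linarith

theorem prod_ltPairs_comp_swap {B : Finset σ} {i j : σ} (hi : i ∈ B) (hj : j ∈ B) (hij : i ≠ j)
    (x : σ → R) :
    ∏ y ∈ ltPairs B, (x (Equiv.swap i j y.1) - x (Equiv.swap i j y.2)) =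
      -∏ y ∈ ltPairs B, (x y.1 - x y.2) := by
  have key : ∀ f : σ → R, ∏ y ∈ ltPairs B, (f y.1 - f y.2) = ∏ a : Fin B.card,
      ∏ b ∈ Ioi a, (f (B.orderEmbOfFin rfl a) - f (B.orderEmbOfFin rfl b)) := by
    intro f
    rw [ltPairs, prod_filter, prod_product]
    have hB : ∀ g : σ → R, ∏ t ∈ B, g t = ∏ a : Fin B.card, g (B.orderEmbOfFin rfl a) :=
      fun g => by
        conv_lhs => rw [← map_orderEmbOfFin_univ B rfl]
        rw [prod_map]
        rfl
    simp only [hB, OrderEmbedding.lt_iff_lt, ← prod_filter]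
    refine prod_congr rfl fun a _ => prod_congr ?_ fun _ _ => rfl
    ext b
    simp
  have hmem : ∀ t ∈ B, ∃ a, B.orderEmbOfFin rfl a = t := fun t ht => by
    rwa [← Set.mem_range, range_orderEmbOfFin, mem_coe]
  obtain ⟨a, rfl⟩ := hmem i hi
  obtain ⟨b, rfl⟩ := hmem j hj
  have hab : a ≠ b := fun h => hij (h ▸ rfl)
  have h := (Equiv.swap a b).prod_Ioi_comp_eq_sign_mul_prod
    (f := fun s t => x (B.orderEmbOfFin rfl s) - x (B.orderEmbOfFin rfl t))
    fun _ _ => (neg_sub _ _).symm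
  rw [key x, key fun t => x (Equiv.swap _ _ t)]
  simp only [(B.orderEmbOfFin rfl).injective.swap_apply]
  rw [h, Equiv.Perm.sign_swap hab]
  simp

end Pairs

theorem exists_blockProd_eq (B : Finset ℕ) : ∃ c : ℚ, c ≠ 0 ∧ ∀ lam : ℕ → ℚ,
    blockProd B lam = c * ∏ y ∈ ltPairs B, (lam y.1 - lam y.2) := by
  refine ⟨∏ y ∈ ltPairs B, ((y.2 : ℚ) - (y.1 : ℚ))⁻¹, ?_, fun lam => ?_⟩
  · refine prod_ne_zero_iff.mpr fun y hy => inv_ne_zero (sub_ne_zero.mpr ?_)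
    exact_mod_cast (mem_ltPairs.mp hy).2.ne'
  · rw [← prod_mul_distrib, blockProd, ltPairs, prod_filter, prod_product]
    exact prod_congr rfl fun a _ => prod_congr rfl fun b _ => by
      simp only [div_eq_mul_inv, mul_comm]

theorem blockProd_comp_swap {B : Finset ℕ} {i j : ℕ} (hi : i ∈ B) (hj : j ∈ B) (hij : i ≠ j)
    (lam : ℕ → ℚ) : blockProd B (fun t => lam (Equiv.swap i j t)) = -blockProd B lam := by
  obtain ⟨c, -, hc⟩ := exists_blockProd_eq B
  rw [hc, hc, prod_ltPairs_comp_swap hi hj hij, mul_neg]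

theorem blockProd_comp_swap_of_notMem {B : Finset ℕ} {i j : ℕ} (hi : i ∉ B) (hj : j ∉ B)
    (lam : ℕ → ℚ) : blockProd B (fun t => lam (Equiv.swap i j t)) = blockProd B lam := by
  have h : ∀ t ∈ B, Equiv.swap i j t = t := fun t ht =>
    Equiv.swap_apply_of_ne_of_ne (fun h => hi (h ▸ ht)) (fun h => hj (h ▸ ht))
  exact prod_congr rfl fun a ha => prod_congr rfl fun b hb => by simp only [h a ha, h b hb]

/-- The pairs `i < j` lying in a common index block of `K ∩ L`. -/
def blockPairs (p q k : ℕ) : Finset (ℕ × ℕ) :=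
  ltPairs (Icc 1 k) ∪ ltPairs (Icc (k + 1) p) ∪ ltPairs (Icc (p + 1) (2 * p - k)) ∪
    ltPairs (Icc (2 * p - k + 1) (p + q - k)) ∪ ltPairs (Icc (p + q - k + 1) (p + q))

theorem mem_blockPairs {p q k : ℕ} {x : ℕ × ℕ} :
    x ∈ blockPairs p q k ↔ x.1 < x.2 ∧
      (1 ≤ x.1 ∧ x.2 ≤ k ∨ k + 1 ≤ x.1 ∧ x.2 ≤ p ∨ p + 1 ≤ x.1 ∧ x.2 ≤ 2 * p - k ∨
        2 * p - k + 1 ≤ x.1 ∧ x.2 ≤ p + q - k ∨ p + q - k + 1 ≤ x.1 ∧ x.2 ≤ p + q) := by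
  simp only [blockPairs, mem_union, mem_ltPairs, mem_Icc]
  omega

theorem disjoint_ltPairs {B B' : Finset ℕ} (h : Disjoint B B') :
    Disjoint (ltPairs B) (ltPairs B') :=
  disjoint_left.mpr fun _ hx hx' =>
    disjoint_left.mp h (mem_ltPairs.mp hx).1.1 (mem_ltPairs.mp hx').1.1

theorem disjoint_Icc_of_lt {a b c d : ℕ} (h : b < c) : Disjoint (Icc a b) (Icc c d) :=
  disjoint_left.mpr fun x hx hx' => by
    rw [mem_Icc] at hx hx'
    omega

section

variable {p q k : ℕ}

theorem disjoint_ltPairs_blocks (hpq : p ≤ q) (hk : k ≤ p) :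
    Disjoint (ltPairs (Icc 1 k)) (ltPairs (Icc (k + 1) p)) ∧
    Disjoint (ltPairs (Icc 1 k) ∪ ltPairs (Icc (k + 1) p))
      (ltPairs (Icc (p + 1) (2 * p - k))) ∧
    Disjoint (ltPairs (Icc 1 k) ∪ ltPairs (Icc (k + 1) p) ∪ ltPairs (Icc (p + 1) (2 * p - k)))
      (ltPairs (Icc (2 * p - k + 1) (p + q - k))) ∧
    Disjoint (ltPairs (Icc 1 k) ∪ ltPairs (Icc (k + 1) p) ∪ ltPairs (Icc (p + 1) (2 * p - k)) ∪
      ltPairs (Icc (2 * p - k + 1) (p + q - k))) (ltPairs (Icc (p + q - k + 1) (p + q))) := by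
  simp only [disjoint_union_left]
  refine ⟨?_, ⟨?_, ?_⟩, ⟨⟨?_, ?_⟩, ?_⟩, ⟨⟨?_, ?_⟩, ?_⟩, ?_⟩ <;>
    exact disjoint_ltPairs (disjoint_Icc_of_lt (by omega))

theorem exists_PKL_eq (hpq : p ≤ q) (hk : k ≤ p) : ∃ c : ℚ, c ≠ 0 ∧ ∀ lam : ℕ → ℚ,
    PKL p q k lam = c * eval lam (diffProd ℚ (blockPairs p q k)) := by
  obtain ⟨c₁, h₁, e₁⟩ := exists_blockProd_eq (Icc 1 k)
  obtain ⟨c₂, h₂, e₂⟩ := exists_blockProd_eq (Icc (k + 1) p)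
  obtain ⟨c₃, h₃, e₃⟩ := exists_blockProd_eq (Icc (p + 1) (2 * p - k))
  obtain ⟨c₄, h₄, e₄⟩ := exists_blockProd_eq (Icc (2 * p - k + 1) (p + q - k))
  obtain ⟨c₅, h₅, e₅⟩ := exists_blockProd_eq (Icc (p + q - k + 1) (p + q))
  obtain ⟨d₁, d₂, d₃, d₄⟩ := disjoint_ltPairs_blocks hpq hk
  refine ⟨c₁ * c₂ * c₃ * c₄ * c₅, by simp [*], fun lam => ?_⟩
  rw [PKL, e₁, e₂, e₃, e₄, e₅, eval_diffProd, blockPairs, prod_union d₄, prod_union d₃,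
    prod_union d₂, prod_union d₁]
  ring

theorem disjoint_ltPairs_K (p q : ℕ) :
    Disjoint (ltPairs (Icc 1 p)) (ltPairs (Icc (p + 1) (p + q))) :=
  disjoint_ltPairs (disjoint_Icc_of_lt p.lt_succ_self)

theorem exists_PK_eq (p q : ℕ) : ∃ c : ℚ, ∀ lam : ℕ → ℚ, PK p q lam =
    c * eval lam (diffProd ℚ (ltPairs (Icc 1 p) ∪ ltPairs (Icc (p + 1) (p + q)))) := by
  obtain ⟨c₁, -, e₁⟩ := exists_blockProd_eq (Icc 1 p)
  obtain ⟨c₂, -, e₂⟩ := exists_blockProd_eq (Icc (p + 1) (p + q))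
  refine ⟨c₁ * c₂, fun lam => ?_⟩
  rw [PK, e₁, e₂, eval_diffProd, prod_union (disjoint_ltPairs_K p q)]
  ring

theorem card_pairs_eq (hpq : p ≤ q) (hk : k ≤ p) :
    (ltPairs (Icc 1 p) ∪ ltPairs (Icc (p + 1) (p + q))).card =
      (blockPairs p q k).card + (DeltaNL p q k).card + (DeltaP1 p q k).card := by
  have hNL : (DeltaNL p q k).card = k * (p - k) + (p - k) * k := by
    rw [DeltaNL, card_union_of_disjoint, card_product, card_product]
    · simp only [Nat.card_Icc]
      congr 2 <;> omega
    · exact disjoint_product.mpr (.inl (disjoint_Icc_of_lt k.lt_succ_self))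
  have hP1 : (DeltaP1 p q k).card = k * (q - p) + (q - p) * (p - k) := by
    rw [DeltaP1, card_union_of_disjoint, card_product, card_product]
    · simp only [Nat.card_Icc]
      congr 2 <;> omega
    · exact disjoint_product.mpr (.inl (disjoint_Icc_of_lt (by omega)))
  obtain ⟨d₁, d₂, d₃, d₄⟩ := disjoint_ltPairs_blocks hpq hk
  have c₁ := two_mul_card_ltPairs (Icc 1 k)
  have c₂ := two_mul_card_ltPairs (Icc (k + 1) p)
  have c₃ := two_mul_card_ltPairs (Icc (p + 1) (2 * p - k))
  have c₄ := two_mul_card_ltPairs (Icc (2 * p - k + 1) (p + q - k))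
  have c₅ := two_mul_card_ltPairs (Icc (p + q - k + 1) (p + q))
  have c₆ := two_mul_card_ltPairs (Icc 1 p)
  have c₇ := two_mul_card_ltPairs (Icc (p + 1) (p + q))
  rw [hNL, hP1, blockPairs, card_union_of_disjoint d₄, card_union_of_disjoint d₃,
    card_union_of_disjoint d₂, card_union_of_disjoint d₁,
    card_union_of_disjoint (disjoint_ltPairs_K p q)]
  obtain ⟨a, rfl⟩ := Nat.exists_eq_add_of_le hk
  obtain ⟨b, rfl⟩ := Nat.exists_eq_add_of_le hpq
  rw [show (Icc 1 k).card = k by simp] at c₁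
  rw [show (Icc (k + 1) (k + a)).card = a by rw [Nat.card_Icc]; omega] at c₂
  rw [show (Icc (k + a + 1) (2 * (k + a) - k)).card = a by rw [Nat.card_Icc]; omega] at c₃
  rw [show (Icc (2 * (k + a) - k + 1) (k + a + (k + a + b) - k)).card = b by
    rw [Nat.card_Icc]; omega] at c₄
  rw [show (Icc (k + a + (k + a + b) - k + 1) (k + a + (k + a + b))).card = k by
    rw [Nat.card_Icc]; omega] at c₅
  rw [show (Icc 1 (k + a)).card = k + a by simp] at c₆
  rw [show (Icc (k + a + 1) (k + a + (k + a + b))).card = k + a + b by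
    rw [Nat.card_Icc]; omega] at c₇
  rw [Nat.add_sub_cancel_left, Nat.add_sub_cancel_left]
  nlinarith

theorem sigmaSum_eq (S : Finset (ℕ × ℕ)) : sigmaSum S = ∑ x ∈ S, root x.1 x.2 := by
  ext t
  simp [sigmaSum]

theorem exists_DSum_eq (hpq : p ≤ q) (hk : k ≤ p) : ∃ f : MvPolynomial ℕ ℚ,
    f.totalDegree ≤ (blockPairs p q k).card ∧ ∀ lam, DSum p q k lam = eval lam f := by
  obtain ⟨c, hc⟩ := exists_PK_eq p q
  set V := ltPairs (Icc 1 p) ∪ ltPairs (Icc (p + 1) (p + q)) with hV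
  let v : ℕ × ℕ → ℕ → ℚ := fun x => root x.1 x.2
  refine ⟨alternatingTranslate v (DeltaNL p q k)
    (alternatingTranslate v (DeltaP1 p q k) (C c * diffProd ℚ V)), ?_, fun lam => ?_⟩
  · refine totalDegree_alternatingTranslate_le _ _ (totalDegree_alternatingTranslate_le _ _ ?_)
    rw [← card_pairs_eq hpq hk, ← hV]
    exact ((diffProd_isHomogeneous V).C_mul c).totalDegree_le
  · simp only [eval_alternatingTranslate, DSum, mul_sum, v, ← sigmaSum_eq, hc, map_mul, eval_C]
    exact sum_congr rfl fun A _ => sum_congr rfl fun B _ => by rw [pow_add, mul_assoc]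

theorem sigmaSum_map_swap (i j : ℕ) (S : Finset (ℕ × ℕ)) (t : ℕ) :
    sigmaSum (S.map ((Equiv.swap i j).prodCongr (Equiv.swap i j)).toEmbedding) t =
      sigmaSum S (Equiv.swap i j t) := by
  simp only [sigmaSum, sum_map, root]
  refine sum_congr rfl fun x _ => ?_
  simp [← Equiv.swap_apply_eq_iff]

theorem sum_powerset_map_equiv {α M : Type*} [AddCommMonoid M] (e : α ≃ α) {S : Finset α}
    (hS : ∀ x, e x ∈ S ↔ x ∈ S) (F : Finset α → M) :
    ∑ A ∈ S.powerset, F (A.map e.toEmbedding) = ∑ A ∈ S.powerset, F A := by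
  refine sum_equiv e.finsetCongr (fun A => ?_) fun A _ => rfl
  simp only [mem_powerset, Equiv.finsetCongr_apply, subset_iff, mem_map_equiv]
  exact ⟨fun h x hx => by simpa using (hS (e.symm x)).mpr (h hx),
    fun h x hx => (hS x).mp (h (by simpa using hx))⟩

theorem PK_comp_swap (hpq : p ≤ q) (hk : k ≤ p) {i j : ℕ} (hij : (i, j) ∈ blockPairs p q k)
    (lam : ℕ → ℚ) : PK p q (fun t => lam (Equiv.swap i j t)) = -PK p q lam := by
  obtain ⟨hlt, h⟩ := mem_blockPairs.mp hij
  dsimp only at hlt h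
  rw [PK, PK]
  by_cases hj : j ≤ p
  · rw [blockProd_comp_swap (mem_Icc.mpr (by omega)) (mem_Icc.mpr (by omega)) hlt.ne,
      blockProd_comp_swap_of_notMem (by rw [mem_Icc]; omega) (by rw [mem_Icc]; omega), neg_mul]
  · rw [blockProd_comp_swap (B := Icc (p + 1) (p + q)) (mem_Icc.mpr (by omega))
        (mem_Icc.mpr (by omega)) hlt.ne,
      blockProd_comp_swap_of_notMem (by rw [mem_Icc]; omega) (by rw [mem_Icc]; omega), mul_neg]

theorem swap_mem_Icc_iff {a b i j : ℕ} (h : i ∈ Icc a b ↔ j ∈ Icc a b) (t : ℕ) :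
    Equiv.swap i j t ∈ Icc a b ↔ t ∈ Icc a b := by
  rw [Equiv.swap_apply_def]
  split_ifs with h₁ h₂
  · rw [h₁, h]
  · rw [h₂, h]
  · rfl

theorem swap_mem_DeltaNL_iff (hpq : p ≤ q) (hk : k ≤ p) {i j : ℕ}
    (hij : (i, j) ∈ blockPairs p q k) (x : ℕ × ℕ) :
    (Equiv.swap i j).prodCongr (Equiv.swap i j) x ∈ DeltaNL p q k ↔ x ∈ DeltaNL p q k := by
  obtain ⟨hlt, h⟩ := mem_blockPairs.mp hij
  dsimp only at hlt h
  simp only [DeltaNL, mem_union, mem_product, Equiv.prodCongr_apply, Prod.map_fst, Prod.map_snd]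
  repeat rw [swap_mem_Icc_iff (by rw [mem_Icc, mem_Icc]; omega)]

theorem swap_mem_DeltaP1_iff (hpq : p ≤ q) (hk : k ≤ p) {i j : ℕ}
    (hij : (i, j) ∈ blockPairs p q k) (x : ℕ × ℕ) :
    (Equiv.swap i j).prodCongr (Equiv.swap i j) x ∈ DeltaP1 p q k ↔ x ∈ DeltaP1 p q k := by
  obtain ⟨hlt, h⟩ := mem_blockPairs.mp hij
  dsimp only at hlt h
  simp only [DeltaP1, mem_union, mem_product, Equiv.prodCongr_apply, Prod.map_fst, Prod.map_snd]
  repeat rw [swap_mem_Icc_iff (by rw [mem_Icc, mem_Icc]; omega)]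

theorem DSum_comp_swap (hpq : p ≤ q) (hk : k ≤ p) {i j : ℕ} (hij : (i, j) ∈ blockPairs p q k)
    (lam : ℕ → ℚ) : DSum p q k (fun t => lam (Equiv.swap i j t)) = -DSum p q k lam := by
  rw [DSum, ← sum_powerset_map_equiv _ (swap_mem_DeltaNL_iff hpq hk hij), DSum,
    ← sum_neg_distrib]
  refine sum_congr rfl fun A _ => ?_
  rw [← sum_powerset_map_equiv _ (swap_mem_DeltaP1_iff hpq hk hij), ← sum_neg_distrib]
  refine sum_congr rfl fun B _ => ?_
  simp only [sigmaSum_map_swap, card_map]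
  rw [PK_comp_swap hpq hk hij fun t => lam t - sigmaSum A t - sigmaSum B t, mul_neg]

theorem DSum_eq_zero (hpq : p ≤ q) (hk : k ≤ p) {i j : ℕ} (hij : (i, j) ∈ blockPairs p q k)
    {lam : ℕ → ℚ} (h : lam i = lam j) : DSum p q k lam = 0 := by
  have hlam : (fun t => lam (Equiv.swap i j t)) = lam := by
    ext t
    rw [Equiv.swap_apply_def]
    split_ifs with h₁ h₂
    · rw [h₁, h]
    · rw [h₂, h]
    · rfl
  have := DSum_comp_swap hpq hk hij lam
  rw [hlam] at this
  linarith

end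

/-- There exists a rational constant `c` such that for all `λ ∈ ℚ^n`,
`∑_{A ⊆ Δ_n^+(𝔩)} ∑_{C ⊆ Δ(𝔭_1)} (−1)^{|A|+|C|} P_K(λ − σ(A) − σ(C)) = c · P_{K∩L}(λ)`. -/
theorem stmt_1 (p q k : ℕ) (hp : 1 ≤ p) (hpq : p ≤ q) (hk : k ≤ p) :
    ∃ c : ℚ, ∀ lam : ℕ → ℚ, DSum p q k lam = c * PKL p q k lam := by
  obtain ⟨f, hdeg, hf⟩ := exists_DSum_eq hpq hk
  obtain ⟨c, hc, hPKL⟩ := exists_PKL_eq hpq hk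
  obtain ⟨d, rfl⟩ := exists_eq_C_mul_diffProd (fun x hx => (mem_blockPairs.mp hx).1)
    (fun x hx => MvPolynomial.funext fun lam => by
      have h : eval lam (identify ℚ x.1 x.2 f) =
          eval (fun t => if t = x.1 then lam x.2 else lam t) f := by
        rw [identify, ← aeval_eq_eval, ← aeval_eq_eval, ← AlgHom.comp_apply, comp_aeval]
        congr 2
        ext t
        split_ifs <;> simp
      rw [h, ← hf, map_zero]
      refine DSum_eq_zero hpq hk hx ?_
      simp [(mem_blockPairs.mp hx).1.ne']) hdeg
  refine ⟨d / c, fun lam => ?_⟩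
  rw [hf, hPKL, map_mul, eval_C]
  field_simp
end

section
/- Assume q > p. If A ⊆ Δ_n^+(𝔩) and C ⊆ Δ(𝔭_1) satisfy P_K(λ_0 − σ(A) − σ(C)) ≠ 0, then C = {e_i − e_j : 1 ≤ i ≤ k, 2p−k+1 ≤ j ≤ p+q−k}. -/
open Finset

/-- A nonvanishing block product forces the coordinates in the block to be distinct. -/
lemma injOn_of_blockProd_ne_zero {B : Finset ℕ} {lam : ℕ → ℚ} (h : blockProd B lam ≠ 0) :
    Set.InjOn lam B := by
  have key : ∀ i ∈ B, ∀ j ∈ B, i < j → lam i ≠ lam j := by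
    intro i hi j hj hij heq
    have := Finset.prod_ne_zero_iff.1 (Finset.prod_ne_zero_iff.1 h i hi) j hj
    simp [hij, heq] at this
  intro i hi j hj heq
  rcases lt_trichotomy i j with hij | hij | hij
  · exact absurd heq (key i hi j hj hij)
  · exact hij
  · exact absurd heq.symm (key j hj i hi hij)

lemma sigmaSum_eq_card_sub_card (S : Finset (ℕ × ℕ)) (t : ℕ) :
    sigmaSum S t = ((#{x ∈ S | x.1 = t} : ℕ) : ℚ) - (#{x ∈ S | x.2 = t} : ℕ) := by
  simp only [sigmaSum, root, Finset.sum_sub_distrib, Finset.card_filter, Nat.cast_sum,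
    Nat.cast_ite, Nat.cast_one, Nat.cast_zero, eq_comm]

lemma card_filter_snd_le {S : Finset (ℕ × ℕ)} {t : ℕ} {T : Finset ℕ}
    (h : ∀ x ∈ S, x.2 = t → x.1 ∈ T) : #{x ∈ S | x.2 = t} ≤ #T := by
  refine Finset.card_le_card_of_injOn Prod.fst ?_ ?_
  · intro x hx
    have hx := Finset.mem_filter.1 hx
    exact h x hx.1 hx.2
  · intro x hx y hy hxy
    have hx := Finset.mem_filter.1 hx
    have hy := Finset.mem_filter.1 hy
    exact Prod.ext hxy (hx.2.trans hy.2.symm)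

lemma card_filter_fst_le {S : Finset (ℕ × ℕ)} {t : ℕ} {T : Finset ℕ}
    (h : ∀ x ∈ S, x.1 = t → x.2 ∈ T) : #{x ∈ S | x.1 = t} ≤ #T := by
  refine Finset.card_le_card_of_injOn Prod.snd ?_ ?_
  · intro x hx
    have hx := Finset.mem_filter.1 hx
    exact h x hx.1 hx.2
  · intro x hx y hy hxy
    have hx := Finset.mem_filter.1 hx
    have hy := Finset.mem_filter.1 hy
    exact Prod.ext (hx.2.trans hy.2.symm) hxy

lemma image_eq_Icc_of_injOn {M : Finset ℕ} {f : ℕ → ℤ} {a b : ℤ} (hinj : Set.InjOn f M)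
    (hmem : ∀ t ∈ M, f t ∈ Finset.Icc a b) (hcard : (b + 1 - a).toNat ≤ #M) :
    M.image f = Finset.Icc a b := by
  refine Finset.eq_of_subset_of_card_le (Finset.image_subset_iff.2 hmem) ?_
  rw [Finset.card_image_of_injOn hinj, Int.card_Icc]
  exact hcard

/-- An injection of `M` onto an interval that is bounded above by another such injection
coincides with it. -/
lemma eqOn_of_image_eq_of_le {M : Finset ℕ} {f h : ℕ → ℤ} (hf : Set.InjOn f M)
    (hh : Set.InjOn h M) (himg : M.image f = M.image h) (hle : ∀ t ∈ M, f t ≤ h t) :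
    ∀ t ∈ M, f t = h t := by
  refine (Finset.sum_eq_sum_iff_of_le hle).1 ?_
  have h1 := Finset.sum_image (f := fun v : ℤ => v) hf
  have h2 := Finset.sum_image (f := fun v : ℤ => v) hh
  rw [← h1, ← h2, himg]

/-- Assuming `q > p`: if `A ⊆ Δ_n^+(𝔩)` and `C ⊆ Δ(𝔭_1)` satisfy
`P_K(λ_0 − σ(A) − σ(C)) ≠ 0`, then `C = {e_i − e_j : 1 ≤ i ≤ k, 2p−k+1 ≤ j ≤ p+q−k}`. -/
theorem stmt_3 (p q k : ℕ) (hp : 1 ≤ p) (hpq : p < q) (hk : k ≤ p)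
    (A : Finset (ℕ × ℕ)) (hA : A ⊆ DeltaNL p q k)
    (C : Finset (ℕ × ℕ)) (hC : C ⊆ DeltaP1 p q k)
    (hne : PK p q (fun t => lam0 p q k t - sigmaSum A t - sigmaSum C t) ≠ 0) :
    C = Finset.Icc 1 k ×ˢ Finset.Icc (2 * p - k + 1) (p + q - k) := by
  have hA' : ∀ x ∈ A, (1 ≤ x.1 ∧ x.1 ≤ k ∧ p + 1 ≤ x.2 ∧ x.2 ≤ 2 * p - k) ∨
      (k + 1 ≤ x.1 ∧ x.1 ≤ p ∧ p + q - k + 1 ≤ x.2 ∧ x.2 ≤ p + q) := by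
    intro x hx
    simpa [DeltaNL, and_assoc] using hA hx
  have hC' : ∀ x ∈ C, (1 ≤ x.1 ∧ x.1 ≤ k ∧ 2 * p - k + 1 ≤ x.2 ∧ x.2 ≤ p + q - k) ∨
      (2 * p - k + 1 ≤ x.1 ∧ x.1 ≤ p + q - k ∧ k + 1 ≤ x.2 ∧ x.2 ≤ p) := by
    intro x hx
    simpa only [DeltaP1, Finset.mem_union, Finset.mem_product, Finset.mem_Icc, and_assoc]
      using hC hx
  -- The coordinates with indices above `p` are integers.
  obtain ⟨f, hf⟩ : ∃ f : ℕ → ℤ, ∀ t, f t =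
      (if t ≤ 2 * p - k then 2 * (p : ℤ) - k + 1 - t
        else if t ≤ p + q - k then (q : ℤ) + 2 * p - 2 * k + 1 - t
        else (p : ℤ) + q + 1 - t) -
      ((#{x ∈ A | x.1 = t} : ℤ) - #{x ∈ A | x.2 = t}) -
      ((#{x ∈ C | x.1 = t} : ℤ) - #{x ∈ C | x.2 = t}) := ⟨_, fun _ => rfl⟩
  have hcast : ∀ t ∈ Finset.Icc (p + 1) (p + q),
      lam0 p q k t - sigmaSum A t - sigmaSum C t = (f t : ℚ) := by
    intro t ht
    rw [Finset.mem_Icc] at ht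
    rw [hf, sigmaSum_eq_card_sub_card, sigmaSum_eq_card_sub_card, lam0,
      if_neg (by omega), if_neg (by omega)]
    push_cast
    rfl
  have hinj : Set.InjOn f (Finset.Icc (p + 1) (p + q)) := by
    intro i hi j hj hij
    refine injOn_of_blockProd_ne_zero (right_ne_zero_of_mul hne) hi hj ?_
    simp only [hcast i hi, hcast j hj, hij]
  have A_fst : ∀ t, p < t → #{x ∈ A | x.1 = t} = 0 := by
    intro t ht
    refine Nat.le_zero.1 (card_filter_fst_le (T := ∅) fun x hx hxt => ?_)
    have := hA' x hx
    omega
  have A_snd : ∀ t, t ≤ 2 * p - k → #{x ∈ A | x.2 = t} ≤ k := by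
    intro t ht
    refine (card_filter_snd_le (T := Finset.Icc 1 k) fun x hx hxt => ?_).trans (by simp)
    have := hA' x hx
    rw [Finset.mem_Icc]
    omega
  have A_snd_mid : ∀ t, 2 * p - k < t → t ≤ p + q - k → #{x ∈ A | x.2 = t} = 0 := by
    intro t ht ht'
    refine Nat.le_zero.1 (card_filter_snd_le (T := ∅) fun x hx hxt => ?_)
    have := hA' x hx
    omega
  have A_snd_last : ∀ t, p + q - k < t → #{x ∈ A | x.2 = t} ≤ p - k := by
    intro t ht
    refine (card_filter_snd_le (T := Finset.Icc (k + 1) p) fun x hx hxt => ?_).trans (by simp)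
    have := hA' x hx
    rw [Finset.mem_Icc]
    omega
  have C_fst : ∀ t, p < t → #{x ∈ C | x.1 = t} ≤ p - k := by
    intro t ht
    refine (card_filter_fst_le (T := Finset.Icc (k + 1) p) fun x hx hxt => ?_).trans (by simp)
    have := hC' x hx
    rw [Finset.mem_Icc]
    omega
  have C_snd : ∀ t, p < t → #{x ∈ C | x.2 = t} ≤ k := by
    intro t ht
    refine (card_filter_snd_le (T := Finset.Icc 1 k) fun x hx hxt => ?_).trans (by simp)
    have := hC' x hx
    rw [Finset.mem_Icc]
    omega
  have C_fst_outer : ∀ t, p < t → (t ≤ 2 * p - k ∨ p + q - k < t) →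
      #{x ∈ C | x.1 = t} = 0 := by
    intro t ht ht'
    refine Nat.le_zero.1 (card_filter_fst_le (T := ∅) fun x hx hxt => ?_)
    have := hC' x hx
    omega
  have C_snd_outer : ∀ t, p < t → (t ≤ 2 * p - k ∨ p + q - k < t) →
      #{x ∈ C | x.2 = t} = 0 := by
    intro t ht ht'
    refine Nat.le_zero.1 (card_filter_snd_le (T := ∅) fun x hx hxt => ?_)
    have := hC' x hx
    omega
  -- The coordinates in the two outer blocks exhaust `1, …, p`.
  have houter : (Finset.Icc (p + 1) (2 * p - k) ∪ Finset.Icc (p + q - k + 1) (p + q)).image f =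
      Finset.Icc 1 (p : ℤ) := by
    refine image_eq_Icc_of_injOn (hinj.mono ?_) ?_ ?_
    · intro t ht
      simp only [Finset.coe_union, Finset.coe_Icc, Set.mem_union, Set.mem_Icc] at ht ⊢
      omega
    · intro t ht
      simp only [Finset.mem_union, Finset.mem_Icc] at ht ⊢
      rw [hf, A_fst t (by omega), C_fst_outer t (by omega) (by omega),
        C_snd_outer t (by omega) (by omega)]
      rcases ht with ht | ht
      · have := A_snd t (by omega)
        rw [if_pos (by omega)]
        omega
      · have := A_snd_last t (by omega)
        rw [if_neg (by omega), if_neg (by omega)]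
        omega
    · rw [Finset.card_union_of_disjoint, Nat.card_Icc, Nat.card_Icc]
      · omega
      · rw [Finset.disjoint_left]
        intro t ht
        rw [Finset.mem_Icc] at ht ⊢
        omega
  have hmid : ∀ t ∈ Finset.Icc (2 * p - k + 1) (p + q - k), f t =
      (q : ℤ) + 2 * p - 2 * k + 1 - t - #{x ∈ C | x.1 = t} + #{x ∈ C | x.2 = t} := by
    intro t ht
    rw [Finset.mem_Icc] at ht
    rw [hf, A_fst t (by omega), A_snd_mid t (by omega) (by omega), if_neg (by omega),
      if_pos (by omega)]
    push_cast
    ring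
  have hmid_inj : Set.InjOn f (Finset.Icc (2 * p - k + 1) (p + q - k)) := by
    refine hinj.mono fun t ht => ?_
    simp only [Finset.coe_Icc, Set.mem_Icc] at ht ⊢
    omega
  -- Hence those in the middle block exhaust `p + 1, …, q`.
  have hmid_img : (Finset.Icc (2 * p - k + 1) (p + q - k)).image f =
      Finset.Icc (p + 1 : ℤ) q := by
    refine image_eq_Icc_of_injOn hmid_inj ?_ ?_
    · intro t ht
      have hft := hmid t ht
      rw [Finset.mem_Icc] at ht
      have h1 := C_fst t (by omega)
      have h2 := C_snd t (by omega)
      have hnot : f t ∉ Finset.Icc 1 (p : ℤ) := by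
        rw [← houter, Finset.mem_image]
        rintro ⟨s, hs, hst⟩
        simp only [Finset.mem_union, Finset.mem_Icc] at hs
        have := hinj (by simp only [Finset.coe_Icc, Set.mem_Icc]; omega)
          (by simp only [Finset.coe_Icc, Set.mem_Icc]; omega) hst
        omega
      rw [Finset.mem_Icc] at hnot ⊢
      omega
    · rw [Nat.card_Icc]
      omega
  have htop_inj : Set.InjOn (fun t : ℕ => (q : ℤ) + 2 * p - k + 1 - t)
      (Finset.Icc (2 * p - k + 1) (p + q - k)) := by
    intro i _ j _ hij
    simp only at hij
    omega
  have htop_img : (Finset.Icc (2 * p - k + 1) (p + q - k)).image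
      (fun t : ℕ => (q : ℤ) + 2 * p - k + 1 - t) = Finset.Icc (p + 1 : ℤ) q := by
    refine image_eq_Icc_of_injOn htop_inj ?_ ?_
    · intro t ht
      rw [Finset.mem_Icc] at ht ⊢
      omega
    · rw [Nat.card_Icc]
      omega
  have hext := eqOn_of_image_eq_of_le hmid_inj htop_inj (hmid_img.trans htop_img.symm) (by
    intro t ht
    rw [hmid t ht]
    rw [Finset.mem_Icc] at ht
    have := C_snd t (by omega)
    omega)
  have hcol : ∀ t ∈ Finset.Icc (2 * p - k + 1) (p + q - k),
      #{x ∈ C | x.1 = t} = 0 ∧ #{x ∈ C | x.2 = t} = k := by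
    intro t ht
    have h1 := hext t ht
    rw [hmid t ht] at h1
    rw [Finset.mem_Icc] at ht
    have := C_snd t (by omega)
    omega
  refine Finset.eq_of_subset_of_card_le ?_ ?_
  · intro x hx
    rw [Finset.mem_product, Finset.mem_Icc, Finset.mem_Icc]
    rcases hC' x hx with h | h
    · omega
    · have h0 := (hcol x.1 (Finset.mem_Icc.2 ⟨h.1, h.2.1⟩)).1
      rw [Finset.card_eq_zero, Finset.filter_eq_empty_iff] at h0
      exact absurd rfl (h0 hx)
  · calc #(Finset.Icc 1 k ×ˢ Finset.Icc (2 * p - k + 1) (p + q - k))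
        = ∑ t ∈ Finset.Icc (2 * p - k + 1) (p + q - k), #{x ∈ C | x.2 = t} := by
          rw [Finset.sum_congr rfl fun t ht => (hcol t ht).2, Finset.sum_const,
            Finset.card_product, Nat.card_Icc, smul_eq_mul, mul_comm, Nat.add_sub_cancel]
      _ ≤ #C := by
          rw [Finset.sum_card_fiberwise_eq_card_filter]
          exact Finset.card_filter_le _ _
end
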